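/- arXiv:1809.03812 — 13 statements merged into one kernel-verified Lean document; each statement's English description precedes it below -/
import Mathlib

section
/- Let V : ℝ → ℝ be infinitely differentiable. Define sequences of functions (α_j), (β_j), (γ_j) : ℝ → ℝ recursively by α₀ ≡ 1/2, β₀ ≡ 0, and for every j ≥ 0: γ_j = (1/2)(V·α_j + β_j') − ∑_{i=1}^{j}(α_i·γ_{j−i} − β_i·β_{j−i}), α_{j+1} = −(1/2)(V·α_j + β_j') − ∑_{i=1}^{j}(α_i·γ_{j−i} − β_i·β_{j−i}), and β_{j+1} = −(1/4)V'·α_j − (1/4)β_j'' − V·β_j. Then for every j ≥ 0 the following identities of functions hold: α_j' = 2β_j, β_j' = −α_{j+1} − V·α_j + γ_j, γ_j' = −2β_{j+1} − 2V·β_j, and α_{j+1} + γ_j = −2∑_{i=1}^{j}(α_i·γ_{j−i} − β_i·β_{j−i}). -/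
open Finset

/-- A sum over `{1, …, n}` is the sum over `{0, …, n}` without its zeroth term. -/
theorem sum_Icc_one_eq_sum_range_sub (f : ℕ → ℝ) (n : ℕ) :
    ∑ i ∈ Icc 1 n, f i = ∑ i ∈ range (n + 1), f i - f 0 := by
  induction n with
  | zero => simp
  | succ n ih => rw [sum_Icc_succ_top (by omega), ih, sum_range_succ _ (n + 1)]; ring

theorem sum_range_mul_reflect_comm (a b : ℕ → ℝ) (n : ℕ) :
    ∑ i ∈ range (n + 1), a i * b (n - i) = ∑ i ∈ range (n + 1), b i * a (n - i) := by
  rw [← sum_flip]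
  refine sum_congr rfl fun i hi => ?_
  rw [Nat.sub_sub_self (by simpa [Nat.lt_succ_iff] using hi), mul_comm]

theorem sum_Icc_one_mul_reflect_comm (a b : ℕ → ℝ) (n : ℕ) :
    ∑ i ∈ Icc 1 n, a i * b (n - i + 1) = ∑ i ∈ Icc 1 n, b i * a (n - i + 1) := by
  refine sum_nbij' (fun i => n - i + 1) (fun i => n - i + 1) ?_ ?_ ?_ ?_ ?_ <;>
    intro i hi <;> rw [mem_Icc] at hi
  · rw [mem_Icc]; omega
  · rw [mem_Icc]; omega
  · omega
  · omega
  · rw [show n - (n - i + 1) + 1 = i by omega, mul_comm]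

/-- The algebraic cancellation behind the derivative of the convolution
`∑ i ∈ Icc 1 n, (a i * c (n - i) - b i * b (n - i))`, where `b' k` stands for the derivative
of `b k`. -/
theorem sum_convolution_deriv_eq (a b c b' : ℕ → ℝ) (v : ℝ) (ha : a 0 = 1 / 2) (hb : b 0 = 0)
    (hb0' : b' 0 = 0) (hb' : ∀ k, b' k = -a (k + 1) - v * a k + c k) (n : ℕ) :
    ∑ i ∈ Icc 1 n, (2 * b i * c (n - i) + a i * (-2 * b (n - i + 1) - 2 * v * b (n - i))
      - (b' i * b (n - i) + b i * b' (n - i))) = v * b n := by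
  have hbb : ∑ i ∈ Icc 1 n, b' i * b (n - i) = ∑ i ∈ Icc 1 n, b i * b' (n - i) := by
    rw [sum_Icc_one_eq_sum_range_sub, sum_Icc_one_eq_sum_range_sub, sum_range_mul_reflect_comm,
      hb, hb0', zero_mul, zero_mul]
  have hab : ∑ i ∈ Icc 1 n, b i * a (n - i) = ∑ i ∈ Icc 1 n, a i * b (n - i) + 1 / 2 * b n := by
    rw [sum_Icc_one_eq_sum_range_sub, sum_Icc_one_eq_sum_range_sub, sum_range_mul_reflect_comm,
      hb, ha, Nat.sub_zero]
    ring
  have hshift := sum_Icc_one_mul_reflect_comm a b n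
  have hexp : ∑ i ∈ Icc 1 n, b i * b' (n - i) = -∑ i ∈ Icc 1 n, b i * a (n - i + 1)
      - v * ∑ i ∈ Icc 1 n, b i * a (n - i) + ∑ i ∈ Icc 1 n, b i * c (n - i) := by
    rw [mul_sum, ← sum_neg_distrib, ← sum_sub_distrib, ← sum_add_distrib]
    refine sum_congr rfl fun i _ => ?_
    rw [hb']
    ring
  have hsplit : ∑ i ∈ Icc 1 n, (2 * b i * c (n - i)
        + a i * (-2 * b (n - i + 1) - 2 * v * b (n - i))
        - (b' i * b (n - i) + b i * b' (n - i)))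
      = 2 * ∑ i ∈ Icc 1 n, b i * c (n - i) - 2 * ∑ i ∈ Icc 1 n, a i * b (n - i + 1)
        - 2 * v * ∑ i ∈ Icc 1 n, a i * b (n - i)
        - (∑ i ∈ Icc 1 n, b' i * b (n - i) + ∑ i ∈ Icc 1 n, b i * b' (n - i)) := by
    simp only [mul_sum, ← sum_sub_distrib, ← sum_add_distrib]
    refine sum_congr rfl fun i _ => ?_
    ring
  rw [hsplit, hbb, hexp, hab, hshift]
  ring

/-- Given a smooth potential `V`, sequences of functions `α, β, γ`
defined by the recurrence relations (2.24) of the paper (with `α₀ ≡ 1/2`, `β₀ ≡ 0`)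
solve the differential equations (2.22) and the constraint (2.23). -/
theorem hadamard_coefficients_solve_recurrence
    (V : ℝ → ℝ) (hV : ContDiff ℝ (⊤ : ℕ∞) V)
    (α β γ : ℕ → ℝ → ℝ)
    (hα0 : ∀ τ, α 0 τ = 1 / 2)
    (hβ0 : ∀ τ, β 0 τ = 0)
    (hγdef : ∀ j τ, γ j τ =
      (1 / 2) * (V τ * α j τ + deriv (β j) τ)
        - ∑ i ∈ Finset.Icc 1 j, (α i τ * γ (j - i) τ - β i τ * β (j - i) τ))
    (hαdef : ∀ j τ, α (j + 1) τ =
      -(1 / 2) * (V τ * α j τ + deriv (β j) τ)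
        - ∑ i ∈ Finset.Icc 1 j, (α i τ * γ (j - i) τ - β i τ * β (j - i) τ))
    (hβdef : ∀ j τ, β (j + 1) τ =
      -(1 / 4) * deriv V τ * α j τ - (1 / 4) * deriv (deriv (β j)) τ - V τ * β j τ) :
    ∀ j : ℕ,
      (∀ τ, deriv (α j) τ = 2 * β j τ) ∧
      (∀ τ, deriv (β j) τ = -α (j + 1) τ - V τ * α j τ + γ j τ) ∧
      (∀ τ, deriv (γ j) τ = -2 * β (j + 1) τ - 2 * V τ * β j τ) ∧
      (∀ τ, α (j + 1) τ + γ j τ =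
        -2 * ∑ i ∈ Finset.Icc 1 j, (α i τ * γ (j - i) τ - β i τ * β (j - i) τ)) := by
  have hβ' : ∀ j τ, deriv (β j) τ = -α (j + 1) τ - V τ * α j τ + γ j τ := fun j τ => by
    rw [hαdef, hγdef]; ring
  have hsum : ∀ j τ, α (j + 1) τ + γ j τ =
      -2 * ∑ i ∈ Finset.Icc 1 j, (α i τ * γ (j - i) τ - β i τ * β (j - i) τ) := fun j τ => by
    rw [hαdef, hγdef]; ring
  have hderiv : ∀ f : ℝ → ℝ, ContDiff ℝ (⊤ : ℕ∞) f → ContDiff ℝ (⊤ : ℕ∞) (deriv f) :=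
    fun f hf => (contDiff_infty_iff_deriv.1 hf).2
  have hsmooth : ∀ j, ContDiff ℝ (⊤ : ℕ∞) (α j) ∧ ContDiff ℝ (⊤ : ℕ∞) (β j) ∧
      ContDiff ℝ (⊤ : ℕ∞) (γ j) := by
    intro j
    induction j using Nat.strong_induction_on with
    | _ j ih =>
    have hαβ : ContDiff ℝ (⊤ : ℕ∞) (α j) ∧ ContDiff ℝ (⊤ : ℕ∞) (β j) := by
      cases j with
      | zero =>
        rw [show α 0 = fun _ => 1 / 2 from funext hα0, show β 0 = fun _ => 0 from funext hβ0]
        exact ⟨contDiff_const, contDiff_const⟩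
      | succ k =>
        obtain ⟨hαk, hβk, -⟩ := ih k k.lt_succ_self
        have hdβ := hderiv _ hβk
        have hddβ := hderiv _ hdβ
        have hdV := hderiv _ hV
        constructor
        · rw [funext (hαdef k)]
          refine (contDiff_const.mul ((hV.mul hαk).add hdβ)).sub (ContDiff.sum fun i hi => ?_)
          rw [Finset.mem_Icc] at hi
          obtain ⟨hαi, hβi, -⟩ := ih i (by omega)
          obtain ⟨-, hβki, hγki⟩ := ih (k - i) (by omega)
          exact (hαi.mul hγki).sub (hβi.mul hβki)
        · rw [funext (hβdef k)]
          exact (((contDiff_const.mul hdV).mul hαk).sub (contDiff_const.mul hddβ)).sub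
            (hV.mul hβk)
    refine ⟨hαβ.1, hαβ.2, ?_⟩
    rw [funext (hγdef j)]
    refine (contDiff_const.mul ((hV.mul hαβ.1).add (hderiv _ hαβ.2))).sub
      (ContDiff.sum fun i hi => ?_)
    rw [Finset.mem_Icc] at hi
    obtain ⟨-, hβji, hγji⟩ := ih (j - i) (by omega)
    rcases hi.2.lt_or_eq with hij | rfl
    · obtain ⟨hαi, hβi, -⟩ := ih i hij
      exact (hαi.mul hγji).sub (hβi.mul hβji)
    · exact (hαβ.1.mul hγji).sub (hαβ.2.mul hβji)
  have hdiff : ∀ f : ℝ → ℝ, ContDiff ℝ (⊤ : ℕ∞) f → ∀ τ, HasDerivAt f (deriv f τ) τ :=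
    fun f hf τ => ((contDiff_infty_iff_deriv.1 hf).1 τ).hasDerivAt
  have hDα j := hdiff _ (hsmooth j).1
  have hDβ j := hdiff _ (hsmooth j).2.1
  have hDγ j := hdiff _ (hsmooth j).2.2
  have hαγ' : ∀ j, (∀ τ, deriv (α j) τ = 2 * β j τ) ∧
      (∀ τ, deriv (γ j) τ = -2 * β (j + 1) τ - 2 * V τ * β j τ) := by
    intro j
    induction j using Nat.strong_induction_on with
    | _ j ih =>
    have hα' : ∀ τ, deriv (α j) τ = 2 * β j τ := by
      cases j with
      | zero =>
        intro τ
        rw [show α 0 = fun _ => 1 / 2 from funext hα0, deriv_const, hβ0, mul_zero]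
      | succ k =>
        intro τ
        obtain ⟨hαk, hγk⟩ := ih k k.lt_succ_self
        have hrel : α (k + 1) = fun τ => γ k τ - (V τ * α k τ + deriv (β k) τ) :=
          funext fun τ => by rw [hβ' k τ]; ring
        have h := (hDγ k τ).fun_sub (((hdiff V hV τ).fun_mul (hDα k τ)).fun_add
          (hdiff _ (hderiv _ (hsmooth k).2.1) τ))
        rw [hrel, h.deriv, hγk, hαk]
        linarith [hβdef k τ]
    refine ⟨hα', fun τ => ?_⟩
    have hconv : HasDerivAt
        (fun τ => ∑ i ∈ Finset.Icc 1 j, (α i τ * γ (j - i) τ - β i τ * β (j - i) τ))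
        (V τ * β j τ) τ := by
      rw [← sum_convolution_deriv_eq (fun i => α i τ) (fun i => β i τ) (fun i => γ i τ)
        (fun i => deriv (β i) τ) (V τ) (hα0 τ) (hβ0 τ)
        (by rw [show β 0 = fun _ => 0 from funext hβ0, deriv_const]) (fun k => hβ' k τ) j]
      refine HasDerivAt.fun_sum fun i hi => ?_
      rw [Finset.mem_Icc] at hi
      have hαi : deriv (α i) τ = 2 * β i τ := by
        rcases hi.2.lt_or_eq with hij | rfl
        · exact (ih i hij).1 τ
        · exact hα' τ
      have h := ((hDα i τ).fun_mul (hDγ (j - i) τ)).fun_sub ((hDβ i τ).fun_mul (hDβ (j - i) τ))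
      rwa [hαi, (ih (j - i) (by omega)).2 τ] at h
    have h := ((((hdiff V hV τ).fun_mul (hDα j τ)).fun_add
      (hdiff _ (hderiv _ (hsmooth j).2.1) τ)).const_mul (1 / 2)).fun_sub hconv
    rw [funext (hγdef j), h.deriv, hα']
    linarith [hβdef j τ]
  exact fun j => ⟨(hαγ' j).1, hβ' j, (hαγ' j).2, hsum j⟩
end

section
/- Let m ∈ ℝ and define, for j ∈ ℕ, α_j = (1/2)·binom(−1/2, j)·m^(2j) and γ_j = (1/2)·binom(1/2, j+1)·m^(2j+2), where binom(x, j) = (∏_{i=0}^{j−1}(x − i))/j! is the generalized binomial coefficient for real x. Then for every j ≥ 0: α_{j+1} − γ_j = −m²·α_j and α_{j+1} + γ_j = −2·∑_{i=1}^{j} α_i·γ_{j−i}. -/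
open Finset

/-- The generalized binomial coefficient `binom x j = (∏_{i=0}^{j-1} (x - i)) / j!`
for real `x` (with `binom x 0 = 1` by the empty-product convention). -/
noncomputable def genBinom (x : ℝ) (j : ℕ) : ℝ :=
  (∏ i ∈ Finset.range j, (x - i)) / (Nat.factorial j)

theorem genBinom_eq_choose (x : ℝ) (j : ℕ) : genBinom x j = Ring.choose x j := by
  rw [Ring.choose_eq_smul, ← Polynomial.aeval_eq_smeval, Polynomial.aeval_def,
    Polynomial.eval₂_eq_eval_map, descPochhammer_map, descPochhammer_eval_eq_prod_range,
    genBinom, smul_eq_mul, div_eq_inv_mul]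

/-- Pascal's rule for the generalized binomial coefficient. -/
theorem genBinom_add_one_succ (x : ℝ) (j : ℕ) :
    genBinom (x + 1) (j + 1) = genBinom x j + genBinom x (j + 1) := by
  simp only [genBinom_eq_choose, Ring.choose_succ_succ]

/-- The Chu–Vandermonde identity for `x + (-x) = 0`, with the two extreme terms split off. -/
theorem genBinom_neg_add_genBinom (x : ℝ) (j : ℕ) :
    genBinom (-x) (j + 1) + genBinom x (j + 1) =
      -∑ i ∈ Finset.Icc 1 j, genBinom (-x) i * genBinom x (j - i + 1) := by
  have vandermonde := Ring.add_choose_eq (j + 1) (Commute.all (-x) x)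
  rw [neg_add_cancel, Ring.choose_zero_succ,
    Finset.Nat.sum_antidiagonal_eq_sum_range_succ_mk, Finset.sum_range_succ,
    Finset.range_eq_Ico, Finset.sum_eq_sum_Ico_succ_bot (Nat.succ_pos j)] at vandermonde
  have inner : ∑ i ∈ Finset.Icc 1 j, genBinom (-x) i * genBinom x (j - i + 1) =
      ∑ i ∈ Finset.Ico 1 (j + 1), Ring.choose (-x) i * Ring.choose x (j + 1 - i) := by
    refine Finset.sum_congr (by ext; simp) fun i hi => ?_
    rw [genBinom_eq_choose, genBinom_eq_choose, Nat.sub_add_comm]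
    simp at hi
    omega
  rw [inner, genBinom_eq_choose, genBinom_eq_choose]
  simp at vandermonde
  linarith

/-- The closed-form coefficients
`α_j = (1/2)·binom(−1/2,j)·m^(2j)` and `γ_j = (1/2)·binom(1/2,j+1)·m^(2j+2)`
solve the Minkowski recurrence relations. -/
theorem minkowski_coefficients_solve_recurrence
    (m : ℝ) (α γ : ℕ → ℝ)
    (hα : ∀ j, α j = (1 / 2) * genBinom (-(1 / 2)) j * m ^ (2 * j))
    (hγ : ∀ j, γ j = (1 / 2) * genBinom (1 / 2) (j + 1) * m ^ (2 * j + 2)) :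
    ∀ j : ℕ,
      α (j + 1) - γ j = -m ^ 2 * α j ∧
      α (j + 1) + γ j = -2 * ∑ i ∈ Finset.Icc 1 j, α i * γ (j - i) := by
  intro j
  constructor
  · have pascal := genBinom_add_one_succ (-(1 / 2)) j
    rw [show (-(1 / 2) + 1 : ℝ) = 1 / 2 by norm_num] at pascal
    rw [hα, hα, hγ, pascal]
    ring
  · have terms : ∑ i ∈ Finset.Icc 1 j, α i * γ (j - i) = (1 / 4) * m ^ (2 * j + 2) *
        ∑ i ∈ Finset.Icc 1 j, genBinom (-(1 / 2)) i * genBinom (1 / 2) (j - i + 1) := by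
      rw [Finset.mul_sum]
      refine Finset.sum_congr rfl fun i hi => ?_
      obtain ⟨k, rfl⟩ := Nat.exists_eq_add_of_le (Finset.mem_Icc.mp hi).2
      rw [hα, hγ, Nat.add_sub_cancel_left]
      ring
    rw [terms, hα, hγ]
    linear_combination (1 / 2) * m ^ (2 * j + 2) * genBinom_neg_add_genBinom (1 / 2) j
end

section
/- Fix μ > 0 and for each integer j ≥ 1 define h_{2j} : (0,∞) → ℝ by h_{2j}(r) = ((−1)^j/(2π²))·(r^(2j−2)/(2j−1)!)·(log(r/μ) − ψ(2j)), where ψ(k) = H_{k−1} − γ with H_k = ∑_{i=1}^{k} 1/i the k-th harmonic number and γ the Euler–Mascheroni constant. Then: (a) for every j ≥ 2 and every r > 0, −(h_{2j}''(r) + (2/r)·h_{2j}'(r)) = h_{2j−2}(r); (b) for every n ≥ 0 and every i ≥ n + 2, the n-fold iterate of the radial Laplacian Δ_r (where (Δ_r f)(r) = f''(r) + (2/r)·f'(r)) applied to h_{2i} tends to 0 as r → 0⁺. -/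
open Finset Filter

/-- The digamma value at a positive integer: `ψ(k) = H_{k−1} − γ`, where `H_k` is the
`k`-th harmonic number and `γ` is the Euler–Mascheroni constant. -/
noncomputable def digammaNat (k : ℕ) : ℝ :=
  (∑ i ∈ Finset.Icc 1 (k - 1), (1 : ℝ) / i) - Real.eulerMascheroniConstant

/-- The homogeneous distribution kernel `h_{2j}` (indexed here by `j`):
`h_{2j}(r) = ((−1)^j/(2π²))·(r^(2j−2)/(2j−1)!)·(log(r/μ) − ψ(2j))`. -/
noncomputable def hKernel (μ : ℝ) (j : ℕ) : ℝ → ℝ := fun r =>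
  ((-1 : ℝ) ^ j / (2 * Real.pi ^ 2)) * (r ^ (2 * j - 2) / (Nat.factorial (2 * j - 1))) *
    (Real.log (r / μ) - digammaNat (2 * j))

/-- The radial Laplacian `(Δ_r f)(r) = f''(r) + (2/r)·f'(r)`. -/
noncomputable def radialLaplacian (f : ℝ → ℝ) : ℝ → ℝ := fun r =>
  deriv (deriv f) r + (2 / r) * deriv f r

/-- Derivative of `C · r^(m+1) · (log (r/μ) − a) + D · r^(m+1)` away from the origin. -/
theorem hasDerivAt_pow_mul_log_div {μ : ℝ} (hμ : 0 < μ) (C D a : ℝ) (m : ℕ) {r : ℝ} (hr : 0 < r) :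
    HasDerivAt (fun x : ℝ => C * x ^ (m + 1) * (Real.log (x / μ) - a) + D * x ^ (m + 1))
      (C * (m + 1) * r ^ m * (Real.log (r / μ) - a) + (C + D * (m + 1)) * r ^ m) r := by
  have hlog : HasDerivAt (fun x : ℝ => Real.log (x / μ) - a) (1 / r) r := by
    refine ((((hasDerivAt_id' r).div_const μ).log (div_pos hr hμ).ne').sub_const a).congr_deriv ?_
    field_simp
  have hpow := hasDerivAt_pow (m + 1) r
  refine (((hpow.const_mul C).mul hlog).add (hpow.const_mul D)).congr_deriv ?_
  rw [Nat.add_sub_cancel]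
  push_cast
  field_simp
  ring

theorem digammaNat_add_two (k : ℕ) (hk : 1 ≤ k) :
    digammaNat (k + 2) = digammaNat k + 1 / k + 1 / (k + 1) := by
  obtain ⟨m, rfl⟩ := Nat.exists_eq_add_of_le' hk
  simp only [digammaNat, Nat.add_sub_cancel, show m + 1 + 2 - 1 = m + 1 + 1 by omega]
  rw [Finset.sum_Icc_succ_top (by omega), Finset.sum_Icc_succ_top (by omega)]
  push_cast
  ring

theorem radialLaplacian_hKernel {μ : ℝ} (hμ : 0 < μ) (k : ℕ) {r : ℝ} (hr : 0 < r) :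
    radialLaplacian (hKernel μ (k + 2)) r = -hKernel μ (k + 1) r := by
  set a := digammaNat (2 * (k + 2)) with ha
  set C : ℝ := (-1 : ℝ) ^ (k + 2) / (2 * Real.pi ^ 2) / (Nat.factorial (2 * k + 3)) with hC
  have hfun : hKernel μ (k + 2) = fun x : ℝ =>
      C * x ^ (2 * k + 1 + 1) * (Real.log (x / μ) - a) + 0 * x ^ (2 * k + 1 + 1) := by
    funext x
    simp only [hKernel, hC, ← ha, show 2 * (k + 2) - 2 = 2 * k + 1 + 1 by omega,
      show 2 * (k + 2) - 1 = 2 * k + 3 by omega]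
    ring
  have hderiv := fun {x : ℝ} (hx : 0 < x) =>
    (hasDerivAt_pow_mul_log_div hμ C 0 a (2 * k + 1) hx).deriv
  have hderiv_eventually := Filter.eventuallyEq_of_mem (Ioi_mem_nhds hr) fun x hx => hderiv hx
  have hdigamma : a = digammaNat (2 * (k + 1)) + 1 / (2 * k + 2) + 1 / (2 * k + 3) := by
    rw [ha, show 2 * (k + 2) = 2 * (k + 1) + 2 by ring, digammaNat_add_two _ (by omega)]
    push_cast
    ring
  rw [radialLaplacian, hfun, hderiv_eventually.deriv_eq, hderiv hr,
    (hasDerivAt_pow_mul_log_div hμ _ _ a (2 * k) hr).deriv, hdigamma]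
  simp only [hKernel, hC, show 2 * (k + 1) - 2 = 2 * k by omega,
    show 2 * (k + 1) - 1 = 2 * k + 1 by omega, Nat.factorial_succ (2 * k + 2),
    Nat.factorial_succ (2 * k + 1)]
  have hfactorial : ((2 * k + 1).factorial : ℝ) ≠ 0 := by positivity
  push_cast
  field_simp
  ring

theorem radialLaplacian_eq_of_eqOn_Ioi {f g : ℝ → ℝ} {c : ℝ}
    (h : Set.EqOn f (fun x => c * g x) (Set.Ioi 0)) {r : ℝ} (hr : 0 < r) :
    radialLaplacian f r = c * radialLaplacian g r := by
  have hfg := Filter.eventuallyEq_of_mem (Ioi_mem_nhds hr) h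
  simp only [radialLaplacian, hfg.deriv.deriv_eq, hfg.deriv_eq, deriv_const_mul_field']
  ring

theorem iterate_radialLaplacian_hKernel {μ : ℝ} (hμ : 0 < μ) (n k : ℕ) :
    Set.EqOn (radialLaplacian^[n] (hKernel μ (k + 1 + n)))
      (fun x => (-1) ^ n * hKernel μ (k + 1) x) (Set.Ioi 0) := by
  induction n generalizing k with
  | zero => intro r _; simp
  | succ n ih =>
    intro r hr
    have h := ih (k + 1)
    rw [Function.iterate_succ_apply', show k + 1 + (n + 1) = k + 1 + 1 + n by ring,
      radialLaplacian_eq_of_eqOn_Ioi h hr, radialLaplacian_hKernel hμ k hr]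
    ring

theorem tendsto_hKernel_zero {μ : ℝ} (hμ : 0 < μ) (k : ℕ) :
    Tendsto (hKernel μ (k + 2)) (nhdsWithin 0 (Set.Ioi 0)) (nhds 0) := by
  set C : ℝ := (-1 : ℝ) ^ (k + 2) / (2 * Real.pi ^ 2) / (Nat.factorial (2 * k + 3)) with hC
  set b := Real.log μ + digammaNat (2 * (k + 2)) with hb
  have hcont : Continuous fun x : ℝ => C * x ^ (2 * k + 1) * (x * Real.log x - b * x) := by
    have := Real.continuous_mul_log
    fun_prop
  have hlim := (hcont.tendsto 0).mono_left (nhdsWithin_le_nhds (s := Set.Ioi 0))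
  simp only [mul_zero, zero_mul, sub_zero] at hlim
  refine hlim.congr' (Filter.eventuallyEq_of_mem self_mem_nhdsWithin fun x hx => ?_)
  have hx : (0 : ℝ) < x := hx
  simp only [hKernel, hC, hb, show 2 * (k + 2) - 2 = 2 * k + 1 + 1 by omega,
    show 2 * (k + 2) - 1 = 2 * k + 3 by omega, Real.log_div hx.ne' hμ.ne']
  ring

/-- (a) The kernels satisfy `−Δ_r h_{2j} = h_{2j−2}` for `j ≥ 2` on `(0,∞)`;
(b) for `i ≥ n + 2`, the `n`-fold radial Laplacian of `h_{2i}` tends to `0` as `r → 0⁺`. -/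
theorem hKernel_homogeneity_and_vanishing (μ : ℝ) (hμ : 0 < μ) :
    (∀ j : ℕ, 2 ≤ j → ∀ r : ℝ, 0 < r →
      -(deriv (deriv (hKernel μ j)) r + (2 / r) * deriv (hKernel μ j) r)
        = hKernel μ (j - 1) r) ∧
    (∀ n i : ℕ, n + 2 ≤ i →
      Tendsto (radialLaplacian^[n] (hKernel μ i)) (nhdsWithin 0 (Set.Ioi 0)) (nhds 0)) := by
  refine ⟨fun j hj r hr => ?_, fun n i hi => ?_⟩
  · obtain ⟨k, rfl⟩ := Nat.exists_eq_add_of_le' hj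
    exact neg_eq_iff_eq_neg.mpr (radialLaplacian_hKernel hμ k hr)
  · obtain ⟨k, rfl⟩ := Nat.exists_eq_add_of_le' hi
    have hlim := (tendsto_hKernel_zero hμ k).const_mul ((-1 : ℝ) ^ n)
    rw [mul_zero] at hlim
    refine hlim.congr' (Filter.eventuallyEq_of_mem self_mem_nhdsWithin fun x hx => ?_)
    rw [show k + (n + 2) = k + 1 + 1 + n by ring]
    exact (iterate_radialLaplacian_hKernel hμ n (k + 1) hx).symm
end

section
/- Call a real 3×3 matrix M A-shaped if M_{jk} = 0 for every index pair (j,k) outside {(0,1),(1,0),(1,2),(2,1)}, and B-shaped if M_{jk} = 0 for every (j,k) outside {(1,0),(2,1)} (indices in {0,1,2}). Let n ≥ 1 and let M₁,…,M_n be real 3×3 matrices such that each M_i is A-shaped or B-shaped. If the number of indices i for which M_i is B-shaped is strictly greater than ⌈(n+1)/2⌉, then the product M₁·M₂·⋯·M_n is the zero matrix. -/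
/-- A real 3×3 matrix is `A`-shaped if its only possibly non-zero entries are at positions
`(0,1), (1,0), (1,2), (2,1)`. -/
def AShaped (M : Matrix (Fin 3) (Fin 3) ℝ) : Prop :=
  ∀ j k : Fin 3,
    (j, k) ∉ ({(0, 1), (1, 0), (1, 2), (2, 1)} : Set (Fin 3 × Fin 3)) → M j k = 0

/-- A real 3×3 matrix is `B`-shaped if its only possibly non-zero entries are at positions
`(1,0), (2,1)`. -/
def BShaped (M : Matrix (Fin 3) (Fin 3) ℝ) : Prop :=
  ∀ j k : Fin 3,
    (j, k) ∉ ({(1, 0), (2, 1)} : Set (Fin 3 × Fin 3)) → M j k = 0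

open Classical in
/-- A nonzero entry `(j, k)` of a `B`-shaped matrix has `k + 1 ≤ j`; for an `A`-shaped matrix it
has `k - 1 ≤ j`. -/
theorem shape_weight_le_of_entry_ne_zero {M : Matrix (Fin 3) (Fin 3) ℝ}
    (hM : AShaped M ∨ BShaped M) {j k : Fin 3} (h : M j k ≠ 0) :
    (if BShaped M then 1 else -1 : ℤ) ≤ (j : ℤ) - (k : ℤ) := by
  split_ifs with hB
  · have hjk := not_imp_comm.1 (hB j k) h
    simp only [Set.mem_insert_iff, Set.mem_singleton_iff, Prod.mk.injEq] at hjk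
    rcases hjk with ⟨rfl, rfl⟩ | ⟨rfl, rfl⟩ <;> decide
  · have hjk := not_imp_comm.1 (hM.resolve_right hB j k) h
    simp only [Set.mem_insert_iff, Set.mem_singleton_iff, Prod.mk.injEq] at hjk
    rcases hjk with ⟨rfl, rfl⟩ | ⟨rfl, rfl⟩ | ⟨rfl, rfl⟩ | ⟨rfl, rfl⟩ <;> decide

open Classical in
/-- If the entry `(j, k)` of a product of `A`- or `B`-shaped matrices is nonzero, then the number
of `B`-shaped factors minus the number of other factors is at most `j - k`. -/
theorem sum_shape_weight_le_of_prod_entry_ne_zero {n : ℕ}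
    {M : Fin n → Matrix (Fin 3) (Fin 3) ℝ} (hM : ∀ i, AShaped (M i) ∨ BShaped (M i))
    {j k : Fin 3} (h : (List.ofFn M).prod j k ≠ 0) :
    ∑ i, (if BShaped (M i) then 1 else -1 : ℤ) ≤ (j : ℤ) - (k : ℤ) := by
  induction n generalizing j with
  | zero =>
    obtain rfl : j = k := by
      by_contra hjk
      exact h (by simp [hjk])
    simp
  | succ n ih =>
    rw [List.ofFn_succ, List.prod_cons, Matrix.mul_apply] at h
    obtain ⟨l, -, hl⟩ := Finset.exists_ne_zero_of_sum_ne_zero h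
    have hhead := shape_weight_le_of_entry_ne_zero (hM 0) (left_ne_zero_of_mul hl)
    have htail := ih (fun i => hM i.succ) (right_ne_zero_of_mul hl)
    rw [Fin.sum_univ_succ]
    linarith

/-- A product of `n` matrices, each `A`-shaped or `B`-shaped, containing
strictly more than `⌈(n+1)/2⌉` `B`-shaped factors vanishes. -/
theorem prod_eq_zero_of_many_BShaped
    (n : ℕ) (hn : 1 ≤ n) (M : Fin n → Matrix (Fin 3) (Fin 3) ℝ)
    (hM : ∀ i, AShaped (M i) ∨ BShaped (M i))
    (hcard : (⌈((n : ℚ) + 1) / 2⌉ : ℤ) < ({i : Fin n | BShaped (M i)}.ncard : ℤ)) :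
    (List.ofFn M).prod = 0 := by
  classical
  ext j k
  by_contra h
  have hle := sum_shape_weight_le_of_prod_entry_ne_zero hM h
  have hsum : ∑ i, (if BShaped (M i) then 1 else -1 : ℤ)
      = 2 * ({i : Fin n | BShaped (M i)}.ncard : ℤ) - n := by
    have hweight : ∀ i, (if BShaped (M i) then 1 else -1 : ℤ)
        = 2 * (if BShaped (M i) then 1 else 0) - 1 := fun i => by split_ifs <;> rfl
    simp_rw [hweight, Finset.sum_sub_distrib, ← Finset.mul_sum]
    simp [Set.ncard_eq_toFinset_card']
  have hceil : ((n : ℚ) + 1) / 2 ≤ (({i : Fin n | BShaped (M i)}.ncard : ℤ) - 1 : ℤ) :=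
    Int.ceil_le.1 (by lia)
  have hn3 : (n : ℤ) + 3 ≤ 2 * ({i : Fin n | BShaped (M i)}.ncard : ℤ) := by
    rw [div_le_iff₀ two_pos] at hceil
    have hint : (n : ℤ) + 1 ≤ (({i : Fin n | BShaped (M i)}.ncard : ℤ) - 1) * 2 := by
      exact_mod_cast hceil
    linarith
  have hj : (j : ℤ) < 3 := by exact_mod_cast j.isLt
  have hk : (0 : ℤ) ≤ (k : ℤ) := Int.natCast_nonneg _
  linarith
end

section
/- Let p ∈ [1,∞), c, ω > 0, and let w_n = c·ωⁿ. Let I ⊆ ℝ be an interval, V : I → ℝ continuous, and τ₀ ∈ I. For τ ∈ I let A(τ) be the 3×3 real matrix with rows (0,2,0), (−V(τ),0,1), (0,−2V(τ),0), and let B be the 3×3 real matrix with rows (0,0,0), (1,0,0), (0,2,0). Then for every M⁰ ∈ ℓ^p(w;ℝ³) there exists a unique continuously differentiable map M : I → ℓ^p(w;ℝ³) with M(τ₀) = M⁰ whose derivative satisfies, for every τ ∈ I and n ∈ ℕ, (∂_τ M(τ))_n = A(τ)·M(τ)_n + B·M(τ)_{n+1}; moreover ‖M(τ)‖_{p,w}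 ≤ exp(C_ω(τ,τ₀))·‖M⁰‖_{p,w} for all τ ∈ I, where C_ω(τ,τ₀) = 2ω|τ−τ₀| + 2|∫_{τ₀}^{τ} √(1+V(η)²) dη|. -/
open scoped ENNReal
open MeasureTheory intervalIntegral

/-- The matrix `A(τ)` of the moment dynamics, with rows `(0,2,0)`, `(−V,0,1)`, `(0,−2V,0)`. -/
noncomputable def matA (v : ℝ) : Matrix (Fin 3) (Fin 3) ℝ :=
  !![0, 2, 0; -v, 0, 1; 0, -2 * v, 0]

/-- The matrix `B` of the moment dynamics, with rows `(0,0,0)`, `(1,0,0)`, `(0,2,0)`. -/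
noncomputable def matB : Matrix (Fin 3) (Fin 3) ℝ :=
  !![0, 0, 0; 1, 0, 0; 0, 2, 0]

/-- `C_ω(τ,τ₀) = 2ω|τ−τ₀| + 2|∫_{τ₀}^{τ} √(1+V(η)²) dη|`. -/
noncomputable def Cω (ω : ℝ) (V : ℝ → ℝ) (τ τ₀ : ℝ) : ℝ :=
  2 * ω * |τ - τ₀| + 2 * |∫ η in τ₀..τ, Real.sqrt (1 + V η ^ 2)|

section LinearODE

open Set Filter Topology

variable {E : Type*} [NormedAddCommGroup E] [NormedSpace ℝ E]

/-- The terms of the Picard (Peano–Baker) series of the linear equation `y' = L(t) y`,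
`y(t₀) = x`. -/
noncomputable def picardTerm (L : ℝ → E →L[ℝ] E) (t₀ : ℝ) (x : E) : ℕ → ℝ → E
  | 0 => fun _ => x
  | n + 1 => fun t => ∫ s in t₀..t, L s (picardTerm L t₀ x n s)

/-- The Picard (Peano–Baker) series of the linear equation `y' = L(t) y`, `y(t₀) = x`. -/
noncomputable def picardSeries (L : ℝ → E →L[ℝ] E) (t₀ : ℝ) (x : E) (t : ℝ) : E :=
  ∑' n, picardTerm L t₀ x n t

theorem picardSeries_self (L : ℝ → E →L[ℝ] E) (t₀ : ℝ) (x : E) :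
    picardSeries L t₀ x t₀ = x := by
  rw [picardSeries, tsum_eq_single 0]
  · rfl
  · rintro (_ | n) hn
    · exact absurd rfl hn
    · simp [picardTerm]

theorem picardTerm_congr {L L' : ℝ → E →L[ℝ] E} {s : Set ℝ} (hs : s.OrdConnected)
    (h : EqOn L L' s) {t₀ : ℝ} (ht₀ : t₀ ∈ s) (x : E) (n : ℕ) :
    EqOn (picardTerm L t₀ x n) (picardTerm L' t₀ x n) s := by
  induction n with
  | zero => exact fun _ _ => rfl
  | succ n ih =>
    intro t ht
    refine integral_congr fun r hr => ?_
    have hr' := hs.uIcc_subset ht₀ ht hr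
    simp only [h hr', ih hr']

theorem picardSeries_congr {L L' : ℝ → E →L[ℝ] E} {s : Set ℝ} (hs : s.OrdConnected)
    (h : EqOn L L' s) {t₀ : ℝ} (ht₀ : t₀ ∈ s) (x : E) :
    EqOn (picardSeries L t₀ x) (picardSeries L' t₀ x) s := fun _ ht =>
  tsum_congr fun n => picardTerm_congr hs h ht₀ x n ht

theorem continuous_picardTerm {L : ℝ → E →L[ℝ] E} (hL : Continuous L) (t₀ : ℝ) (x : E) (n : ℕ) :
    Continuous (picardTerm L t₀ x n) := by
  induction n with
  | zero => exact continuous_const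
  | succ n ih =>
    exact continuous_primitive (fun a b => (hL.clm_apply ih).intervalIntegrable a b) t₀

theorem norm_picardTerm_le {L : ℝ → E →L[ℝ] E} {k : ℝ → ℝ} (hk : Continuous k)
    (hLk : ∀ t, ‖L t‖ ≤ k t) (t₀ : ℝ) (x : E) (n : ℕ) (t : ℝ) :
    ‖picardTerm L t₀ x n t‖ ≤ |∫ s in t₀..t, k s| ^ n / n.factorial * ‖x‖ := by
  induction n generalizing t with
  | zero => simp [picardTerm]
  | succ n ih =>
    set J : ℝ → ℝ := fun t => ∫ s in t₀..t, k s
    set g : ℝ → ℝ := fun u => |u| ^ n / n.factorial * ‖x‖ with hg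
    have hgc : Continuous g := by fun_prop
    have hJd : ∀ s, HasDerivAt J (k s) s := fun s => hk.integral_hasStrictDerivAt t₀ s |>.hasDerivAt
    have hJc : Continuous J := continuous_iff_continuousAt.2 fun s => (hJd s).continuousAt
    have hJ0 : J t₀ = 0 := integral_same
    calc ‖picardTerm L t₀ x (n + 1) t‖
        ≤ |∫ s in t₀..t, (g ∘ J) s * k s| := by
          refine norm_integral_le_abs_of_norm_le (Eventually.of_forall fun s => ?_)
            (((hgc.comp hJc).mul hk).intervalIntegrable _ _)
          calc ‖L s (picardTerm L t₀ x n s)‖ ≤ ‖L s‖ * ‖picardTerm L t₀ x n s‖ :=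
                (L s).le_opNorm _
            _ ≤ k s * g (J s) := by
                have := hLk s
                have := ih s
                gcongr
                exact (norm_nonneg _).trans (hLk s)
            _ = (g ∘ J) s * k s := mul_comm _ _
      _ = |∫ u in (0 : ℝ)..J t, g u| := by
          rw [integral_comp_mul_deriv (fun s _ => hJd s) hk.continuousOn hgc, hJ0]
      _ = |∫ u in (0 : ℝ)..J t, |u - 0| ^ n| * (‖x‖ / n.factorial) := by
          rw [← abs_of_nonneg (show 0 ≤ ‖x‖ / n.factorial by positivity), ← abs_mul,
            ← intervalIntegral.integral_mul_const]
          congr 2 with u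
          simp only [hg, sub_zero]
          ring
      _ = |J t| ^ (n + 1) / (n + 1).factorial * ‖x‖ := by
          rw [abs_integral_eq_abs_integral_uIoc, integral_pow_abs_sub_uIoc, sub_zero,
            abs_of_nonneg (by positivity), Nat.factorial_succ]
          push_cast
          field_simp

/-- Every point of an interval has a relative neighbourhood that is a compact interval, which can
be chosen to contain any other given point of the interval. -/
theorem Set.OrdConnected.exists_Icc_mem_nhdsWithin {I : Set ℝ} (hI : I.OrdConnected) {t₀ t : ℝ}
    (ht₀ : t₀ ∈ I) (ht : t ∈ I) :
    ∃ a b, a ≤ b ∧ t₀ ∈ Icc a b ∧ t ∈ Icc a b ∧ Icc a b ⊆ I ∧ Icc a b ∈ 𝓝[I] t := by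
  obtain ⟨a, haI, hat, ha⟩ : ∃ a ∈ I, a ≤ t ∧ ∀ᶠ s in 𝓝[I] t, a ≤ s := by
    by_cases h : ∃ a ∈ I, a < t
    · obtain ⟨a, ha, hat⟩ := h
      exact ⟨a, ha, hat.le, mem_nhdsWithin_of_mem_nhds (Ici_mem_nhds hat)⟩
    · push Not at h
      exact ⟨t, ht, le_rfl, eventually_mem_nhdsWithin.mono h⟩
  obtain ⟨b, hbI, htb, hb⟩ : ∃ b ∈ I, t ≤ b ∧ ∀ᶠ s in 𝓝[I] t, s ≤ b := by
    by_cases h : ∃ b ∈ I, t < b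
    · obtain ⟨b, hb, htb⟩ := h
      exact ⟨b, hb, htb.le, mem_nhdsWithin_of_mem_nhds (Iic_mem_nhds htb)⟩
    · push Not at h
      exact ⟨t, ht, le_rfl, eventually_mem_nhdsWithin.mono h⟩
  have hmin : min a t₀ ∈ I := by rcases min_choice a t₀ with h | h <;> rwa [h]
  have hmax : max b t₀ ∈ I := by rcases max_choice b t₀ with h | h <;> rwa [h]
  have hmem : t ∈ Icc (min a t₀) (max b t₀) := ⟨min_le_of_left_le hat, le_max_of_le_left htb⟩
  refine ⟨min a t₀, max b t₀, hmem.1.trans hmem.2, ⟨min_le_right _ _, le_max_right _ _⟩,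
    hmem, hI.out hmin hmax, ?_⟩
  filter_upwards [ha, hb] with s hsa hsb
  exact ⟨min_le_of_left_le hsa, le_max_of_le_left hsb⟩

/-- Uniqueness for linear equations with continuous coefficients on an arbitrary interval. -/
theorem eqOn_of_hasDerivWithinAt_clm {L : ℝ → E →L[ℝ] E} {I : Set ℝ} (hI : I.OrdConnected)
    (hL : ContinuousOn L I) {f g : ℝ → E} (hf : ∀ t ∈ I, HasDerivWithinAt f (L t (f t)) I t)
    (hg : ∀ t ∈ I, HasDerivWithinAt g (L t (g t)) I t) {t₀ : ℝ} (ht₀ : t₀ ∈ I)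
    (h₀ : f t₀ = g t₀) : EqOn f g I := by
  intro t ht
  have hsub : uIcc t₀ t ⊆ I := hI.uIcc_subset ht₀ ht
  obtain ⟨C, hC⟩ := isCompact_uIcc.exists_bound_of_continuousOn (hL.mono hsub)
  have hlip : ∀ s ∈ uIcc t₀ t, LipschitzOnWith C.toNNReal (L s) univ := fun s hs =>
    ((L s).lipschitz.weaken (NNReal.coe_le_coe.1
      ((hC s hs).trans (Real.le_coe_toNNReal C)))).lipschitzOnWith
  have hfc : ContinuousOn f (uIcc t₀ t) := fun s hs =>
    ((hf s (hsub hs)).mono hsub).continuousWithinAt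
  have hgc : ContinuousOn g (uIcc t₀ t) := fun s hs =>
    ((hg s (hsub hs)).mono hsub).continuousWithinAt
  rcases le_total t₀ t with h | h
  · rw [uIcc_of_le h] at *
    have key : ∀ {φ : ℝ → E}, (∀ t ∈ I, HasDerivWithinAt φ (L t (φ t)) I t) →
        ∀ s ∈ Ico t₀ t, HasDerivWithinAt φ (L s (φ s)) (Ici s) s := fun hφ s hs =>
      (hφ s (hsub (Ico_subset_Icc_self hs))).mono_of_mem_nhdsWithin <|
        mem_of_superset (Icc_mem_nhdsGE hs.2) ((Icc_subset_Icc_left hs.1).trans hsub)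
    exact ODE_solution_unique_of_mem_Icc_right (v := fun s => L s) (s := fun _ => univ)
      (fun s hs => hlip s (Ico_subset_Icc_self hs)) hfc (key hf) (fun _ _ => mem_univ _)
      hgc (key hg) (fun _ _ => mem_univ _) h₀ ⟨h, le_rfl⟩
  · rw [uIcc_of_ge h] at *
    have key : ∀ {φ : ℝ → E}, (∀ t ∈ I, HasDerivWithinAt φ (L t (φ t)) I t) →
        ∀ s ∈ Ioc t t₀, HasDerivWithinAt φ (L s (φ s)) (Iic s) s := fun hφ s hs =>
      (hφ s (hsub (Ioc_subset_Icc_self hs))).mono_of_mem_nhdsWithin <|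
        mem_of_superset (Icc_mem_nhdsLE hs.1) ((Icc_subset_Icc_right hs.2).trans hsub)
    exact ODE_solution_unique_of_mem_Icc_left (v := fun s => L s) (s := fun _ => univ)
      (fun s hs => hlip s (Ioc_subset_Icc_self hs)) hfc (key hf) (fun _ _ => mem_univ _)
      hgc (key hg) (fun _ _ => mem_univ _) h₀ ⟨le_rfl, h⟩

theorem norm_picardSeries_le {L : ℝ → E →L[ℝ] E} {k : ℝ → ℝ} (hk : Continuous k)
    (hLk : ∀ t, ‖L t‖ ≤ k t) (t₀ : ℝ) (x : E) (t : ℝ) :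
    ‖picardSeries L t₀ x t‖ ≤ Real.exp |∫ s in t₀..t, k s| * ‖x‖ := by
  refine tsum_of_norm_bounded ?_ fun n => norm_picardTerm_le hk hLk t₀ x n t
  rw [Real.exp_eq_exp_ℝ]
  exact (NormedSpace.expSeries_div_hasSum_exp (𝔸 := ℝ) |∫ s in t₀..t, k s|).mul_right ‖x‖

theorem norm_picardSeries_le_of_continuousOn {L : ℝ → E →L[ℝ] E} {k : ℝ → ℝ} {I : Set ℝ}
    (hI : I.OrdConnected) (hk : ContinuousOn k I) (hLk : ∀ t ∈ I, ‖L t‖ ≤ k t)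
    {t₀ t : ℝ} (ht₀ : t₀ ∈ I) (ht : t ∈ I) (x : E) :
    ‖picardSeries L t₀ x t‖ ≤ Real.exp |∫ s in t₀..t, k s| * ‖x‖ := by
  obtain ⟨a, b, hab, h₀, h₁, hsub, -⟩ := hI.exists_Icc_mem_nhdsWithin ht₀ ht
  have hcont : Continuous (IccExtend hab ((Icc a b).domRestrict k)) :=
    (hk.mono hsub).domRestrict.Icc_extend'
  have heqL : EqOn L (IccExtend hab ((Icc a b).domRestrict L)) (Icc a b) := fun s hs =>
    (IccExtend_of_mem hab ((Icc a b).domRestrict L) hs).symm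
  have heqk : EqOn k (IccExtend hab ((Icc a b).domRestrict k)) (uIcc t₀ t) := fun s hs =>
    (IccExtend_of_mem hab ((Icc a b).domRestrict k)
      (ordConnected_Icc.uIcc_subset h₀ h₁ hs)).symm
  rw [picardSeries_congr ordConnected_Icc heqL h₀ x h₁, integral_congr heqk]
  exact norm_picardSeries_le hcont (fun s => hLk _ (hsub (projIcc a b hab s).2)) t₀ x t

variable [CompleteSpace E]

theorem summable_picardTerm {L : ℝ → E →L[ℝ] E} {k : ℝ → ℝ} (hk : Continuous k)
    (hLk : ∀ t, ‖L t‖ ≤ k t) (t₀ : ℝ) (x : E) (t : ℝ) :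
    Summable fun n => picardTerm L t₀ x n t :=
  .of_norm_bounded ((Real.summable_pow_div_factorial _).mul_right _)
    fun n => norm_picardTerm_le hk hLk t₀ x n t

theorem hasDerivAt_picardSeries {L : ℝ → E →L[ℝ] E} (hL : Continuous L) (t₀ : ℝ) (x : E)
    (t : ℝ) : HasDerivAt (picardSeries L t₀ x) (L t (picardSeries L t₀ x t)) t := by
  have hk : Continuous fun s => ‖L s‖ := hL.norm
  have hLk : ∀ s, ‖L s‖ ≤ ‖L s‖ := fun _ => le_rfl
  set r := |t - t₀| + 1
  have hcpt : IsCompact (Metric.closedBall t₀ r) := isCompact_closedBall _ _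
  obtain ⟨C₁, hC₁⟩ := hcpt.exists_bound_of_continuousOn hL.continuousOn
  obtain ⟨C₂, hC₂⟩ := hcpt.exists_bound_of_continuousOn
    (continuous_primitive (μ := volume) (fun a b => hk.intervalIntegrable a b) t₀).continuousOn
  have ht : t ∈ Metric.ball t₀ r := by simp [r, Real.dist_eq]
  have hu : Summable fun n : ℕ => C₁ * (C₂ ^ n / n.factorial * ‖x‖) :=
    ((Real.summable_pow_div_factorial C₂).mul_right ‖x‖).mul_left C₁
  have hterm : ∀ n s, HasDerivAt (picardTerm L t₀ x (n + 1)) (L s (picardTerm L t₀ x n s)) s :=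
    fun n s => ((hL.clm_apply (continuous_picardTerm hL t₀ x n)).integral_hasStrictDerivAt
      t₀ s).hasDerivAt
  have hderiv : HasDerivAt (fun s => ∑' n, picardTerm L t₀ x (n + 1) s)
      (∑' n, L t (picardTerm L t₀ x n t)) t := by
    refine hasDerivAt_tsum_of_isPreconnected hu Metric.isOpen_ball
      (convex_ball t₀ r).isPreconnected (fun n s _ => hterm n s) (fun n s hs => ?_) ht
      ((summable_nat_add_iff 1).2 (summable_picardTerm hk hLk t₀ x t)) ht
    have hs' := Metric.ball_subset_closedBall hs
    have h₁ := hC₁ s hs'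
    have h₂ := hC₂ s hs'
    rw [Real.norm_eq_abs] at h₂
    refine ((L s).le_opNorm _).trans ?_
    have h₃ := norm_picardTerm_le hk hLk t₀ x n s
    have : 0 ≤ C₁ := (norm_nonneg _).trans h₁
    refine (mul_le_mul h₁ h₃ (norm_nonneg _) this).trans ?_
    gcongr
  have hsum : picardSeries L t₀ x = fun s => x + ∑' n, picardTerm L t₀ x (n + 1) s := by
    funext s
    rw [picardSeries, (summable_picardTerm hk hLk t₀ x s).tsum_eq_zero_add]
    rfl
  rw [← (L t).map_tsum (summable_picardTerm hk hLk t₀ x t)] at hderiv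
  exact (hsum ▸ hderiv.const_add x :)

theorem hasDerivWithinAt_picardSeries {L : ℝ → E →L[ℝ] E} {I : Set ℝ} (hI : I.OrdConnected)
    (hL : ContinuousOn L I) {t₀ t : ℝ} (ht₀ : t₀ ∈ I) (ht : t ∈ I) (x : E) :
    HasDerivWithinAt (picardSeries L t₀ x) (L t (picardSeries L t₀ x t)) I t := by
  obtain ⟨a, b, hab, h₀, h₁, hsub, hnhds⟩ := hI.exists_Icc_mem_nhdsWithin ht₀ ht
  have hcont : Continuous (IccExtend hab ((Icc a b).domRestrict L)) :=
    (hL.mono hsub).domRestrict.Icc_extend'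
  have heq : EqOn L (IccExtend hab ((Icc a b).domRestrict L)) (Icc a b) := fun s hs =>
    (IccExtend_of_mem hab ((Icc a b).domRestrict L) hs).symm
  have hser := picardSeries_congr ordConnected_Icc heq h₀ x
  rw [heq h₁, hser h₁]
  exact ((hasDerivAt_picardSeries hcont t₀ x t).hasDerivWithinAt.congr hser
    (hser h₁)).mono_of_mem_nhdsWithin hnhds

end LinearODE

section MomentOperator

theorem toReal_pos_of_one_le {p : ℝ≥0∞} [Fact (1 ≤ p)] (hp : p ≠ ∞) : 0 < p.toReal :=
  ENNReal.toReal_pos (zero_lt_one.trans_le Fact.out).ne' hp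

/-- The left shift on `ℓ^p`, `p < ∞`. -/
noncomputable def lpShift {p : ℝ≥0∞} [Fact (1 ≤ p)] (hp : p ≠ ∞) (X : Type*)
    [NormedAddCommGroup X] [NormedSpace ℝ X] :
    lp (fun _ : ℕ => X) p →L[ℝ] lp (fun _ : ℕ => X) p :=
  LinearMap.mkContinuous
    { toFun := fun f => ⟨fun n => f (n + 1), memℓp_gen ((summable_nat_add_iff 1).2
        ((lp.memℓp f).summable (toReal_pos_of_one_le hp)))⟩
      map_add' := fun _ _ => rfl
      map_smul' := fun _ _ => rfl } 1 fun f => by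
    have hp' := toReal_pos_of_one_le hp
    have hf := (lp.memℓp f).summable hp'
    rw [one_mul]
    refine lp.norm_le_of_tsum_le hp' (norm_nonneg f) ?_
    rw [lp.norm_rpow_eq_tsum hp', hf.tsum_eq_zero_add]
    exact le_add_of_nonneg_left (by positivity)

theorem lpShift_apply {p : ℝ≥0∞} [Fact (1 ≤ p)] (hp : p ≠ ∞) {X : Type*}
    [NormedAddCommGroup X] [NormedSpace ℝ X] (f : lp (fun _ : ℕ => X) p) (n : ℕ) :
    lpShift hp X f n = f (n + 1) := rfl

theorem norm_lpShift_le {p : ℝ≥0∞} [Fact (1 ≤ p)] (hp : p ≠ ∞) (X : Type*)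
    [NormedAddCommGroup X] [NormedSpace ℝ X] : ‖lpShift hp X‖ ≤ 1 :=
  LinearMap.mkContinuous_norm_le _ zero_le_one _

/-- A matrix acting componentwise on `ℓ^p(ℕ; ℝ^ι)`. -/
noncomputable def lpMulVec (p : ℝ≥0∞) [Fact (1 ≤ p)] {ι : Type*} [Fintype ι] [DecidableEq ι]
    (A : Matrix ι ι ℝ) : lp (fun _ : ℕ => ι → ℝ) p →L[ℝ] lp (fun _ : ℕ => ι → ℝ) p :=
  lp.mapCLM p (fun _ => (Matrix.toLin' A).toContinuousLinearMap) (norm_nonneg _) fun _ => le_rfl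

theorem lpMulVec_apply {p : ℝ≥0∞} [Fact (1 ≤ p)] {ι : Type*} [Fintype ι] [DecidableEq ι]
    (A : Matrix ι ι ℝ) (f : lp (fun _ : ℕ => ι → ℝ) p) (n : ℕ) :
    lpMulVec p A f n = A.mulVec (f n) := rfl

theorem norm_lpMulVec_le {p : ℝ≥0∞} [Fact (1 ≤ p)] {ι : Type*} [Fintype ι] [DecidableEq ι]
    {A : Matrix ι ι ℝ} {K : ℝ} (hK : 0 ≤ K) (hA : ∀ x, ‖A.mulVec x‖ ≤ K * ‖x‖) :
    ‖lpMulVec p A‖ ≤ K :=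
  (lp.norm_mapCLM_le p _ _ _).trans (ContinuousLinearMap.opNorm_le_bound _ hK hA)

theorem norm_matB_mulVec_le (x : Fin 3 → ℝ) : ‖matB.mulVec x‖ ≤ 2 * ‖x‖ := by
  have h := fun i => norm_le_pi_norm x i
  refine (pi_norm_le_iff_of_nonneg (by positivity)).2 fun i => ?_
  simp only [Real.norm_eq_abs] at h ⊢
  have h0 := h 0
  have h1 := h 1
  fin_cases i <;> simp [matB, Matrix.mulVec, dotProduct, Fin.sum_univ_three, abs_mul] <;>
    linarith [abs_nonneg (x 0)]

theorem norm_matA_mulVec_le (v : ℝ) (x : Fin 3 → ℝ) :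
    ‖(matA v).mulVec x‖ ≤ 2 * √(1 + v ^ 2) * ‖x‖ := by
  have h := fun i => norm_le_pi_norm x i
  refine (pi_norm_le_iff_of_nonneg (by positivity)).2 fun i => ?_
  have h1 : 1 ≤ √(1 + v ^ 2) := Real.one_le_sqrt.2 (by nlinarith)
  have hv : |v| ≤ √(1 + v ^ 2) := Real.abs_le_sqrt (by linarith)
  simp only [Real.norm_eq_abs] at h ⊢
  fin_cases i <;> simp [matA, Matrix.mulVec, dotProduct, Fin.sum_univ_three, abs_mul]
  · have := mul_le_mul h1 (h 1) (abs_nonneg _) (by positivity)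
    linarith
  · have := mul_le_mul h1 (h 2) (abs_nonneg _) (by positivity)
    have := mul_le_mul hv (h 0) (abs_nonneg _) (by positivity)
    have := abs_add_le (-(v * x 0)) (x 2)
    rw [abs_neg, abs_mul] at this
    linarith
  · have := mul_le_mul hv (h 1) (abs_nonneg _) (by positivity)
    linarith

/-- The generator of the moment dynamics with potential value `v`, acting on the weighted
representatives. -/
noncomputable def momentOperator {p : ℝ≥0∞} [Fact (1 ≤ p)] (hp : p ≠ ∞) (ω v : ℝ) :
    lp (fun _ : ℕ => Fin 3 → ℝ) p →L[ℝ] lp (fun _ : ℕ => Fin 3 → ℝ) p :=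
  lpMulVec p (matA v) + ω • lpMulVec p matB ∘L lpShift hp (Fin 3 → ℝ)

theorem momentOperator_apply {p : ℝ≥0∞} [Fact (1 ≤ p)] (hp : p ≠ ∞) (ω v : ℝ)
    (f : lp (fun _ : ℕ => Fin 3 → ℝ) p) (n : ℕ) :
    momentOperator hp ω v f n = (matA v).mulVec (f n) + ω • matB.mulVec (f (n + 1)) := rfl

theorem continuous_momentOperator {p : ℝ≥0∞} [Fact (1 ≤ p)] (hp : p ≠ ∞) (ω : ℝ) :
    Continuous (momentOperator hp ω) := by
  have h : momentOperator hp ω =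
      fun v => momentOperator hp ω 0 + v • lpMulVec p (matA 1 - matA 0) := by
    funext v
    ext f n i
    change momentOperator hp ω v f n i =
      momentOperator hp ω 0 f n i + v * lpMulVec p (matA 1 - matA 0) f n i
    rw [momentOperator_apply, momentOperator_apply, lpMulVec_apply]
    fin_cases i <;> simp [matA, Matrix.mulVec, dotProduct, Fin.sum_univ_three] <;> ring
  rw [h]
  fun_prop

theorem norm_momentOperator_le {p : ℝ≥0∞} [Fact (1 ≤ p)] (hp : p ≠ ∞) {ω : ℝ} (hω : 0 ≤ ω)
    (v : ℝ) : ‖momentOperator hp ω v‖ ≤ 2 * ω + 2 * √(1 + v ^ 2) := by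
  have hA : ‖lpMulVec p (matA v)‖ ≤ 2 * √(1 + v ^ 2) :=
    norm_lpMulVec_le (by positivity) (norm_matA_mulVec_le v)
  have hB : ‖lpMulVec p matB‖ ≤ 2 := norm_lpMulVec_le zero_le_two norm_matB_mulVec_le
  have hBS : ‖lpMulVec p matB ∘L lpShift hp (Fin 3 → ℝ)‖ ≤ 2 * 1 :=
    (ContinuousLinearMap.opNorm_comp_le _ _).trans
      (mul_le_mul hB (norm_lpShift_le hp _) (norm_nonneg _) zero_le_two)
  refine (norm_add_le _ _).trans ?_
  rw [norm_smul, Real.norm_of_nonneg hω]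
  linarith [mul_le_mul_of_nonneg_left hBS hω]

theorem weighted_moment_equation_iff {p : ℝ≥0∞} [Fact (1 ≤ p)] (hp : p ≠ ∞) {c ω : ℝ}
    (hc : 0 < c) (hω : 0 < ω) (v : ℝ) (f g : lp (fun _ : ℕ => Fin 3 → ℝ) p) :
    (∀ n : ℕ, (c * ω ^ n) • g n
      = (matA v).mulVec ((c * ω ^ n) • f n) + matB.mulVec ((c * ω ^ (n + 1)) • f (n + 1))) ↔
      g = momentOperator hp ω v f := by
  rw [lp.ext_iff, funext_iff]
  refine forall_congr' fun n => ?_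
  have hw : c * ω ^ n ≠ 0 := by positivity
  have hsmul : (matA v).mulVec ((c * ω ^ n) • f n)
      + matB.mulVec ((c * ω ^ (n + 1)) • f (n + 1))
      = (c * ω ^ n) • momentOperator hp ω v f n := by
    simp only [momentOperator_apply, Matrix.mulVec_smul, smul_add, smul_smul, pow_succ, mul_assoc]
  rw [hsmul]
  exact (smul_right_injective (Fin 3 → ℝ) hw).eq_iff

theorem abs_integral_le_Cω {ω : ℝ} (hω : 0 ≤ ω) {V : ℝ → ℝ} {τ₀ τ : ℝ}
    (hV : ContinuousOn V (Set.uIcc τ₀ τ)) :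
    |∫ η in τ₀..τ, (2 * ω + 2 * √(1 + V η ^ 2))| ≤ Cω ω V τ τ₀ := by
  have hint : IntervalIntegrable (fun η => 2 * √(1 + V η ^ 2)) volume τ₀ τ :=
    ContinuousOn.intervalIntegrable (by fun_prop)
  rw [integral_add intervalIntegrable_const hint, intervalIntegral.integral_const,
    intervalIntegral.integral_const_mul, smul_eq_mul, Cω]
  refine (abs_add_le _ _).trans_eq ?_
  simp only [abs_mul, abs_two, abs_of_nonneg hω]
  ring

end MomentOperator

/-- Theorem 4.8 of the paper. For geometrically growing weights
`w n = c·ωⁿ`, a continuous potential `V` on an interval `I` and any initial datum in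
`ℓ^p(w;ℝ³)`, the moment dynamics `(∂_τ M)_n = A(τ)·M_n + B·M_{n+1}` has a unique
continuously differentiable solution on `I`, bounded by `exp(C_ω(τ,τ₀))` times the norm
of the initial datum.  Elements of `ℓ^p(w;ℝ³)` are represented by their weighted
representatives in `lp`: the element `F` of `lp` represents the moment sequence
`n ↦ (c·ωⁿ) • F n`, so that the `lp`-norm of `F` is exactly the `‖·‖_{p,w}`-norm of the
represented moment sequence (with the sup norm on `ℝ³ = Fin 3 → ℝ`). -/
theorem moment_dynamics_geometric_weights
    (p : ℝ≥0∞) [Fact (1 ≤ p)] (hp : p ≠ ∞) (c ω : ℝ) (hc : 0 < c) (hω : 0 < ω)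
    (I : Set ℝ) (hI : I.OrdConnected) (V : ℝ → ℝ) (hV : ContinuousOn V I)
    (τ₀ : ℝ) (hτ₀ : τ₀ ∈ I)
    (M0 : lp (fun _ : ℕ => Fin 3 → ℝ) p) :
    ∃ F F' : ℝ → lp (fun _ : ℕ => Fin 3 → ℝ) p,
      F τ₀ = M0 ∧
      ContinuousOn F' I ∧
      (∀ τ ∈ I, HasDerivWithinAt F (F' τ) I τ) ∧
      (∀ τ ∈ I, ∀ n : ℕ,
        (c * ω ^ n) • (F' τ) n
          = (matA (V τ)).mulVec ((c * ω ^ n) • (F τ) n)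
            + matB.mulVec ((c * ω ^ (n + 1)) • (F τ) (n + 1))) ∧
      (∀ τ ∈ I, ‖F τ‖ ≤ Real.exp (Cω ω V τ τ₀) * ‖M0‖) ∧
      (∀ G G' : ℝ → lp (fun _ : ℕ => Fin 3 → ℝ) p,
        G τ₀ = M0 →
        ContinuousOn G' I →
        (∀ τ ∈ I, HasDerivWithinAt G (G' τ) I τ) →
        (∀ τ ∈ I, ∀ n : ℕ,
          (c * ω ^ n) • (G' τ) n
            = (matA (V τ)).mulVec ((c * ω ^ n) • (G τ) n)
              + matB.mulVec ((c * ω ^ (n + 1)) • (G τ) (n + 1))) →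
        ∀ τ ∈ I, G τ = F τ) := by
  set L : ℝ → lp (fun _ : ℕ => Fin 3 → ℝ) p →L[ℝ] lp (fun _ : ℕ => Fin 3 → ℝ) p :=
    fun τ => momentOperator hp ω (V τ)
  have hL : ContinuousOn L I := (continuous_momentOperator hp ω).comp_continuousOn hV
  have hderiv : ∀ τ ∈ I,
      HasDerivWithinAt (picardSeries L τ₀ M0) (L τ (picardSeries L τ₀ M0 τ)) I τ :=
    fun τ hτ => hasDerivWithinAt_picardSeries hI hL hτ₀ hτ M0
  refine ⟨picardSeries L τ₀ M0, fun τ => L τ (picardSeries L τ₀ M0 τ),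
    picardSeries_self L τ₀ M0, ?_, hderiv, ?_, ?_, ?_⟩
  · exact hL.clm_apply fun τ hτ => (hderiv τ hτ).continuousWithinAt
  · exact fun τ _ => (weighted_moment_equation_iff hp hc hω _ _ _).2 rfl
  · intro τ hτ
    refine (norm_picardSeries_le_of_continuousOn hI
      (k := fun η => 2 * ω + 2 * √(1 + V η ^ 2)) (by fun_prop)
      (fun η _ => norm_momentOperator_le hp hω.le (V η)) hτ₀ hτ M0).trans ?_
    gcongr
    exact abs_integral_le_Cω hω.le (hV.mono (hI.uIcc_subset hτ₀ hτ))
  · intro G G' hG₀ _ hG hGeq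
    refine eqOn_of_hasDerivWithinAt_clm hI hL (fun τ hτ => ?_) hderiv hτ₀
      (hG₀.trans (picardSeries_self L τ₀ M0).symm)
    have h := hG τ hτ
    rwa [(weighted_moment_equation_iff hp hc hω _ _ _).1 (hGeq τ hτ)] at h
end

section
/- Let p ∈ [1,∞) and let w : ℕ → (0,∞) be a weight sequence with w_{n+1}/w_n → ∞ as n → ∞. Let V ∈ ℝ, let A be the complex 3×3 matrix with rows (0,2,0), (−V,0,1), (0,−2V,0), and let B be the complex 3×3 matrix with rows (0,0,0), (1,0,0), (0,2,0). Then for every λ ∈ ℂ the sequence N defined by N_n = 4^(−n)·(4V+λ²)ⁿ·(4, 2λ, λ²) ∈ ℂ³ is nonzero, lies in ℓ^p(w;ℂ³) (i.e., ∑_n (‖N_n‖_∞/w_n)^p < ∞), and satisfies A·N_n + B·N_{n+1} = λ·N_n for every n ∈ ℕ. In particular, every λ ∈ ℂ is an eigenvalue of the operator S = A⊗1 + B⊗L (L the left shift) on ℓ^p(w;ℂ³), so the resolvent set of S is empty. -/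
open scoped ENNReal
open Filter

/-- The complex matrix `A` with rows `(0,2,0)`, `(−V,0,1)`, `(0,−2V,0)`. -/
noncomputable def matAC (V : ℝ) : Matrix (Fin 3) (Fin 3) ℂ :=
  !![0, 2, 0; -(V : ℂ), 0, 1; 0, -2 * (V : ℂ), 0]

/-- The complex matrix `B` with rows `(0,0,0)`, `(1,0,0)`, `(0,2,0)`. -/
noncomputable def matBC : Matrix (Fin 3) (Fin 3) ℂ :=
  !![0, 0, 0; 1, 0, 0; 0, 2, 0]

/-- If the weights grow faster than geometrically, every geometric sequence `zⁿ • v` lies in the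
weighted `ℓ^p` space, for every `p ≥ 1`. -/
theorem memℓp_inv_smul_pow_smul {E : Type*} [NormedAddCommGroup E] [NormedSpace ℂ E]
    {p : ℝ≥0∞} (hp : 1 ≤ p) {w : ℕ → ℝ} (hw : ∀ n, 0 < w n)
    (hgrow : Tendsto (fun n => w (n + 1) / w n) atTop atTop) (z : ℂ) (v : E) :
    Memℓp (fun n => (w n)⁻¹ • z ^ n • v) p := by
  suffices h : Summable fun n => ‖(w n)⁻¹ • z ^ n • v‖ by
    refine Memℓp.of_exponent_ge (memℓp_gen (p := 1) ?_) hp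
    simpa using h
  refine summable_of_ratio_norm_eventually_le (r := 1 / 2) (by norm_num) ?_
  filter_upwards [hgrow.eventually_ge_atTop (2 * ‖z‖)] with n hn
  have hn₀ := hw n
  have hn₁ := hw (n + 1)
  rw [le_div_iff₀ hn₀] at hn
  have hz : (w (n + 1))⁻¹ * ‖z‖ ≤ 1 / 2 * (w n)⁻¹ := by
    field_simp
    linarith
  rw [norm_norm, norm_norm]
  simp only [norm_smul, norm_inv, norm_pow, Real.norm_eq_abs, abs_of_pos hn₀,
    abs_of_pos hn₁]
  calc (w (n + 1))⁻¹ * (‖z‖ ^ (n + 1) * ‖v‖)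
      = (w (n + 1))⁻¹ * ‖z‖ * (‖z‖ ^ n * ‖v‖) := by ring
    _ ≤ 1 / 2 * (w n)⁻¹ * (‖z‖ ^ n * ‖v‖) := by gcongr
    _ = 1 / 2 * ((w n)⁻¹ * (‖z‖ ^ n * ‖v‖)) := by ring

/-- Proposition 4.12 of the paper. If the weights grow faster than
geometrically (`w_{n+1}/w_n → ∞`), then for every `λ ∈ ℂ` the sequence
`N_n = 4^(−n)·(4V+λ²)ⁿ·(4, 2λ, λ²)` is a non-zero element of `ℓ^p(w;ℂ³)` satisfying
`A·N_n + B·N_{n+1} = λ·N_n` for all `n`; hence every `λ ∈ ℂ` is an eigenvalue of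
`S = A⊗1 + B⊗L` and the resolvent set of `S` is empty. -/
theorem shift_operator_empty_resolvent
    (p : ℝ) (hp : 1 ≤ p) (w : ℕ → ℝ) (hw : ∀ n, 0 < w n)
    (hgrow : Tendsto (fun n => w (n + 1) / w n) atTop atTop)
    (V : ℝ) (lam : ℂ) :
    ∀ N : ℕ → Fin 3 → ℂ,
      (∀ n, N n = ((4 * (V : ℂ) + lam ^ 2) / 4) ^ n • ![4, 2 * lam, lam ^ 2]) →
      N ≠ 0 ∧
      Memℓp (fun n => (w n)⁻¹ • N n) (ENNReal.ofReal p) ∧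
      (∀ n : ℕ, (matAC V).mulVec (N n) + matBC.mulVec (N (n + 1)) = lam • N n) := by
  intro N hN
  refine ⟨fun h => ?_, ?_, fun n => ?_⟩
  · have h₀ := congrFun (hN 0) 0
    simp [h] at h₀
  · simp only [hN]
    exact memℓp_inv_smul_pow_smul (ENNReal.one_le_ofReal.2 hp) hw hgrow _ _
  · rw [hN, hN, pow_succ]
    ext i
    fin_cases i <;>
      simp [matAC, matBC] <;> ring
end

section
/- Let m ≥ 1 be an integer and let υ > ω > 0 be real numbers. Then for every n ∈ ℕ: ((2m+2n)!/(2n)!)·(ω^(2m+2n)/υ^(2n)) < m!·(m−1)!·(1/π)·(υ/ω)·(2υω/(υ−ω))^(2m). In particular the supremum over n of the left-hand side is bounded by the right-hand side. -/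
/-- `e ≤ (1 + 1/N)^(N+1)`, with denominators cleared. -/
lemma pow_succ_mul_exp_one_le (N : ℕ) :
    (N : ℝ) ^ (N + 1) * Real.exp 1 ≤ ((N : ℝ) + 1) ^ (N + 1) := by
  have hpos : (0 : ℝ) < (N : ℝ) + 1 := by positivity
  have hbase : (N : ℝ) / (N + 1) ≤ Real.exp (-(1 / ((N : ℝ) + 1))) := by
    refine le_trans (le_of_eq ?_) (Real.add_one_le_exp _)
    field_simp
    ring
  have hpow := pow_le_pow_left₀ (by positivity) hbase (N + 1)
  have hexp : Real.exp (-(1 / ((N : ℝ) + 1))) ^ (N + 1) = (Real.exp 1)⁻¹ := by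
    rw [← Real.exp_nat_mul, ← Real.exp_neg]
    congr 1
    push_cast
    field_simp
  rw [hexp, div_pow, div_le_iff₀ (by positivity)] at hpow
  calc (N : ℝ) ^ (N + 1) * Real.exp 1
      ≤ ((Real.exp 1)⁻¹ * ((N : ℝ) + 1) ^ (N + 1)) * Real.exp 1 := by gcongr
    _ = ((N : ℝ) + 1) ^ (N + 1) := by
      field_simp

/-- The product `(k+1)⋯(k+b)` is at most `(k+1+b)^(k+1+b) / ((k+1)^(k+1) e^b)`. -/
lemma factorial_add_mul_exp_le (k b : ℕ) :
    ((k + b).factorial : ℝ) * ((k : ℝ) + 1) ^ (k + 1) * Real.exp b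
      ≤ k.factorial * ((k : ℝ) + 1 + b) ^ (k + 1 + b) := by
  induction b with
  | zero => simp
  | succ b ih =>
    have hstep := pow_succ_mul_exp_one_le (k + 1 + b)
    push_cast at hstep
    rw [← add_assoc k b 1, Nat.factorial_succ]
    push_cast
    rw [Real.exp_add]
    calc ((k : ℝ) + b + 1) * (k + b).factorial * ((k : ℝ) + 1) ^ (k + 1)
          * (Real.exp b * Real.exp 1)
        = ((k : ℝ) + 1 + b) * Real.exp 1
          * ((k + b).factorial * ((k : ℝ) + 1) ^ (k + 1) * Real.exp b) := by ring
      _ ≤ ((k : ℝ) + 1 + b) * Real.exp 1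
          * (k.factorial * ((k : ℝ) + 1 + b) ^ (k + 1 + b)) := by gcongr
      _ = k.factorial * (((k : ℝ) + 1 + b) ^ (k + 1 + b + 1) * Real.exp 1) := by ring
      _ ≤ k.factorial * ((k : ℝ) + 1 + b + 1) ^ (k + 1 + b + 1) := by gcongr
      _ = k.factorial * ((k : ℝ) + 1 + (b + 1)) ^ (k + 1 + (b + 1)) := by
        rw [← add_assoc, ← add_assoc]

/-- On `[0, 1]` the function `r ↦ r^a (1-r)^b` is maximal at `a / (a+b)`. -/
lemma pow_mul_one_sub_pow_mul_le {a b : ℕ} (ha : 0 < a) (hb : 0 < b) {r : ℝ}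
    (hr₀ : 0 ≤ r) (hr₁ : r ≤ 1) :
    r ^ a * (1 - r) ^ b * ((a : ℝ) + b) ^ (a + b) ≤ (a : ℝ) ^ a * (b : ℝ) ^ b := by
  have ha' : (0 : ℝ) < a := by exact_mod_cast ha
  have hb' : (0 : ℝ) < b := by exact_mod_cast hb
  have hs : 0 ≤ 1 - r := by linarith
  have key (c : ℕ) (x : ℝ) (hx : 0 ≤ x) : x ^ c ≤ Real.exp (c * (x - 1)) := by
    rw [Real.exp_nat_mul]
    gcongr
    linarith [Real.add_one_le_exp (x - 1)]
  have hprod : (r * (a + b) / a) ^ a * ((1 - r) * (a + b) / b) ^ b ≤ 1 := by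
    calc (r * (a + b) / a) ^ a * ((1 - r) * (a + b) / b) ^ b
        ≤ Real.exp (a * (r * (a + b) / a - 1)) * Real.exp (b * ((1 - r) * (a + b) / b - 1)) := by
          gcongr
          · exact key _ _ (by positivity)
          · exact key _ _ (by positivity)
      _ = 1 := by
        rw [← Real.exp_add, Real.exp_eq_one_iff]
        field_simp
        ring
  rw [div_pow, div_pow, div_mul_div_comm, div_le_one (by positivity)] at hprod
  calc r ^ a * (1 - r) ^ b * ((a : ℝ) + b) ^ (a + b)
      = (r * (a + b)) ^ a * ((1 - r) * (a + b)) ^ b := by rw [mul_pow, mul_pow, pow_add]; ring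
    _ ≤ _ := hprod

/-- A bound on `((k+b)!/k!) r^(k+1) (1-r)^b` that is uniform in `k` and `r`. -/
lemma factorial_div_mul_pow_le (k : ℕ) {b : ℕ} (hb : 0 < b) {r : ℝ} (hr₀ : 0 ≤ r) (hr₁ : r ≤ 1) :
    ((k + b).factorial : ℝ) / k.factorial * r ^ (k + 1) * (1 - r) ^ b
      ≤ (b / Real.exp 1) ^ b := by
  have hfac := factorial_add_mul_exp_le k b
  have hmax := pow_mul_one_sub_pow_mul_le k.succ_pos hb hr₀ hr₁
  have hs : 0 ≤ 1 - r := by linarith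
  push_cast at hmax
  have hexp : Real.exp b = Real.exp 1 ^ b := by rw [← Real.exp_nat_mul, mul_one]
  rw [hexp] at hfac
  rw [div_pow, div_mul_eq_mul_div, div_mul_eq_mul_div, div_le_div_iff₀ (by positivity)
    (by positivity)]
  refine le_of_mul_le_mul_right ?_ (by positivity : (0 : ℝ) < ((k : ℝ) + 1) ^ (k + 1))
  calc ((k + b).factorial : ℝ) * r ^ (k + 1) * (1 - r) ^ b * Real.exp 1 ^ b
          * ((k : ℝ) + 1) ^ (k + 1)
      = (k + b).factorial * ((k : ℝ) + 1) ^ (k + 1) * Real.exp 1 ^ b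
          * (r ^ (k + 1) * (1 - r) ^ b) := by ring
    _ ≤ k.factorial * ((k : ℝ) + 1 + b) ^ (k + 1 + b) * (r ^ (k + 1) * (1 - r) ^ b) := by gcongr
    _ = k.factorial * (r ^ (k + 1) * (1 - r) ^ b * ((k : ℝ) + 1 + b) ^ (k + 1 + b)) := by ring
    _ ≤ k.factorial * (((k : ℝ) + 1) ^ (k + 1) * (b : ℝ) ^ b) := by gcongr
    _ = (b : ℝ) ^ b * k.factorial * ((k : ℝ) + 1) ^ (k + 1) := by ring

lemma two_mul_div_exp_pow_lt {m : ℕ} (hm : 1 ≤ m) :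
    (((2 * m : ℕ) : ℝ) / Real.exp 1) ^ (2 * m)
      < m.factorial * (m - 1).factorial * (1 / Real.pi) * 2 ^ (2 * m) := by
  have hm' : (0 : ℝ) < m := by exact_mod_cast hm
  have hfac : (m.factorial : ℝ) = m * (m - 1).factorial := by
    exact_mod_cast (Nat.mul_factorial_pred (by omega)).symm
  have hst := pow_le_pow_left₀ (by positivity) (Stirling.le_factorial_stirling m) 2
  rw [mul_pow, Real.sq_sqrt (by positivity), ← pow_mul, mul_comm m 2] at hst
  have hlt : Real.pi * m * (m / Real.exp 1) ^ (2 * m)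
      < Real.pi * m * (m.factorial * (m - 1).factorial * (1 / Real.pi)) := by
    calc Real.pi * m * (m / Real.exp 1) ^ (2 * m)
        < 2 * Real.pi * m * (m / Real.exp 1) ^ (2 * m) := by
          gcongr
          linarith [Real.pi_pos]
      _ ≤ (m.factorial : ℝ) ^ 2 := hst
      _ = Real.pi * m * (m.factorial * (m - 1).factorial * (1 / Real.pi)) := by
        rw [sq]
        nth_rewrite 2 [hfac]
        field_simp
  push_cast
  rw [mul_div_assoc, mul_pow, mul_comm]
  gcongr
  exact lt_of_mul_lt_mul_left hlt (by positivity)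

/-- the bound (4.12) on the weight ratios `r_m`. For an integer `m ≥ 1`
and reals `υ > ω > 0`, for every `n`:
`((2m+2n)!/(2n)!)·(ω^(2m+2n)/υ^(2n)) < m!·(m−1)!·(1/π)·(υ/ω)·(2υω/(υ−ω))^(2m)`. -/
theorem weight_ratio_bound
    (m : ℕ) (hm : 1 ≤ m) (υ ω : ℝ) (hω : 0 < ω) (hυ : ω < υ) (n : ℕ) :
    ((Nat.factorial (2 * m + 2 * n) : ℝ) / (Nat.factorial (2 * n)))
        * (ω ^ (2 * m + 2 * n) / υ ^ (2 * n))
      < (Nat.factorial m : ℝ) * (Nat.factorial (m - 1)) * (1 / Real.pi) * (υ / ω)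
        * (2 * υ * ω / (υ - ω)) ^ (2 * m) := by
  have hυ₀ : 0 < υ := hω.trans hυ
  have hsub : 0 < υ - ω := sub_pos.mpr hυ
  have hbound := (factorial_div_mul_pow_le (2 * n) (b := 2 * m) (by omega)
    (div_nonneg hω.le hυ₀.le) ((div_le_one hυ₀).mpr hυ.le)).trans_lt (two_mul_div_exp_pow_lt hm)
  rw [add_comm (2 * n) (2 * m), one_sub_div hυ₀.ne'] at hbound
  have hscale := mul_lt_mul_of_pos_right hbound
    (by positivity : 0 < υ / ω * (υ * ω / (υ - ω)) ^ (2 * m))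
  refine lt_of_eq_of_lt ?_ (hscale.trans_eq ?_)
  · simp only [div_pow, mul_pow, pow_add]
    field_simp
  · rw [mul_assoc 2 υ ω, mul_div_assoc, mul_pow]
    ring
end

section
/- Let p ∈ [1,∞), υ > ω ≥ 1, and set w_n = (2n)!·ω^(2n), v_n = (2n)!·υ^(2n), and K = 2υω/(υ−ω). Let I = [τ₀,τ₁] and V : I → ℝ continuous, and for τ ≥ τ₀ set C₀(τ,τ₀) = 2(τ−τ₀) + 2∫_{τ₀}^{τ} √(1+V(η)²) dη. Assume C₀(τ₁,τ₀)·K < 1. Then for every M⁰ ∈ ℓ^p(w;ℝ³) there exists a map M : I → ℓ^p(v;ℝ³) with M(τ₀) = M⁰ such that: (1) M is differentiable as an ℓ^p(v;ℝ³)-valued map with (∂_τ M(τ))_n = A(τ)·M(τ)_n + B·M(τ)_{n+1} for all τ ∈ I, n ∈ ℕ; (2) for every τ ∈ I, ‖M(τ)‖_{p,v} ≤ [exp(C₀(τ,τ₀)) + (C₀(τ,τ₀)·K³/(2π))·(υ/ω)^(1/2)·(3 − 2C₀(τ,τ₀)K)/(1 − C₀(τ,τ₀)K)²]·‖M⁰‖_{p,w};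 (3) ‖M(τ) − M⁰‖_{p,v} → 0 as τ → τ₀. -/
open scoped ENNReal
open MeasureTheory intervalIntegral

/-- `C₀(τ,τ₀) = 2(τ−τ₀) + 2∫_{τ₀}^{τ} √(1+V(η)²) dη`. -/
noncomputable def C₀ (V : ℝ → ℝ) (τ τ₀ : ℝ) : ℝ :=
  2 * (τ - τ₀) + 2 * ∫ η in τ₀..τ, Real.sqrt (1 + V η ^ 2)

lemma choose_mul_pow_le (N M : ℕ) (hM : 2 ≤ M) (x : ℝ) (h0 : 0 < x) (h1 : x < 1) :
    ((N + M).choose N : ℝ) * x ^ N * (1 - x) ^ M * √x ≤ 2 / Real.pi := by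
  have hpi : (3 : ℝ) / 5 ≤ 2 / Real.pi := by
    rw [div_le_div_iff₀ (by norm_num) Real.pi_pos]; linarith [Real.pi_lt_d2]
  refine le_trans ?_ hpi
  have hy : 0 < 1 - x := by linarith
  have hs0 : 0 < √x := Real.sqrt_pos.2 h0
  have hsq : √x ^ 2 = x := Real.sq_sqrt h0.le
  have hs1 : √x ≤ 1 := by nlinarith
  rcases N with _ | N
  · have h2 : (1 - x) ^ M ≤ (1 - x) ^ 1 := pow_le_pow_of_le_one hy.le (by linarith) (by omega)
    simp only [zero_add, Nat.choose_zero_right, Nat.cast_one, pow_zero, one_mul, mul_one]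
    refine (mul_le_mul_of_nonneg_right h2 hs0.le).trans ?_
    rw [pow_one]
    nlinarith [mul_nonneg hs0.le (sq_nonneg (√x - 3/5)), sq_nonneg (√x - 3/5)]
  obtain ⟨m, rfl⟩ : ∃ m, M = m + 1 := ⟨M - 1, by omega⟩
  have hbin := add_pow x (1 - x) (N + 1 + (m + 1))
  rw [add_sub_cancel, one_pow] at hbin
  set t : ℕ → ℝ := fun i => x ^ i * (1 - x) ^ (N + 1 + (m + 1) - i) *
    ((N + 1 + (m + 1)).choose i : ℝ) with ht
  have hsub : ({N, N + 1, N + 2} : Finset ℕ) ⊆ Finset.range (N + 1 + (m + 1) + 1) := by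
    intro i hi; simp only [Finset.mem_insert, Finset.mem_singleton] at hi
    rw [Finset.mem_range]; omega
  have h3 : t N + (t (N + 1) + t (N + 2)) ≤ 1 := by
    rw [hbin]
    refine le_trans (le_of_eq ?_) (Finset.sum_le_sum_of_subset_of_nonneg hsub
      (fun i _ _ => by positivity))
    rw [Finset.sum_insert (by simp), Finset.sum_insert (by simp), Finset.sum_singleton]
  have e1 : ((N + 1 + (m + 1)).choose N : ℝ) * (m + 2)
      = ((N + 1 + (m + 1)).choose (N + 1) : ℝ) * (N + 1) := by
    have := Nat.choose_succ_right_eq (N + 1 + (m + 1)) N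
    rw [show N + 1 + (m + 1) - N = m + 2 by omega] at this
    exact_mod_cast this.symm
  have e2 : ((N + 1 + (m + 1)).choose (N + 2) : ℝ) * (N + 2)
      = ((N + 1 + (m + 1)).choose (N + 1) : ℝ) * (m + 1) := by
    have := Nat.choose_succ_right_eq (N + 1 + (m + 1)) (N + 1)
    rw [show N + 1 + (m + 1) - (N + 1) = m + 1 by omega] at this
    exact_mod_cast this
  simp only [ht] at h3
  rw [show N + 1 + (m + 1) - N = m + 2 by omega, show N + 1 + (m + 1) - (N + 1) = m + 1 by omega,
    show N + 1 + (m + 1) - (N + 2) = m by omega] at h3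
  set c := ((N + 1 + (m + 1)).choose (N + 1) : ℝ)
  set P := c * x ^ (N + 1) * (1 - x) ^ (m + 1) with hP
  have hP0 : 0 ≤ P := by positivity
  set α := x ^ N * (1 - x) ^ (m + 2) * ((N + 1 + (m + 1)).choose N : ℝ) with hα
  set β := x ^ (N + 2) * (1 - x) ^ m * ((N + 1 + (m + 1)).choose (N + 2) : ℝ) with hβ
  have hα0 : 0 ≤ α := by positivity
  have hβ0 : 0 ≤ β := by positivity
  have hprod : α * β * ((m + 2) * (N + 2)) = P ^ 2 * ((N + 1) * (m + 1)) := by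
    calc α * β * ((m + 2) * (N + 2))
      _ = x ^ N * (1 - x) ^ (m + 2) * (x ^ (N + 2) * (1 - x) ^ m) *
          (((N + 1 + (m + 1)).choose N : ℝ) * (m + 2)) *
          (((N + 1 + (m + 1)).choose (N + 2) : ℝ) * (N + 2)) := by rw [hα, hβ]; ring
      _ = P ^ 2 * ((N + 1) * (m + 1)) := by rw [e1, e2, hP]; ring
  have hm : (1 : ℝ) ≤ m := by exact_mod_cast (by omega : 1 ≤ m)
  have hN : (0 : ℝ) ≤ N := by positivity
  have hab : P ^ 2 ≤ 3 * (α * β) := by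
    have : P ^ 2 * ((m + 2) * (N + 2)) ≤ 3 * (α * β) * ((m + 2) * (N + 2)) := by
      have : P ^ 2 * ((m + 2) * (N + 2)) ≤ P ^ 2 * (3 * ((N + 1) * (m + 1))) := by
        refine mul_le_mul_of_nonneg_left ?_ (sq_nonneg P)
        nlinarith [mul_nonneg hN (by linarith : (0 : ℝ) ≤ m)]
      nlinarith
    exact le_of_mul_le_mul_right this (by positivity)
  have h4 : α + (P + β) ≤ 1 := by rw [hP]; linarith
  have hP1 : P ≤ 3 / 5 := by
    by_contra! h
    nlinarith [sq_nonneg (α - β)]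
  nlinarith

/-- The factor by which the `k`-th term of the Dyson series of the moment dynamics grows, up to
`k!`. -/
noncomputable def momentGrowth (υ ω : ℝ) (k : ℕ) : ℝ :=
  1 / k.factorial + (2 * υ * ω / (υ - ω)) ^ 2 / (2 * Real.pi) * √(υ / ω) *
    (if k = 0 then 0 else (k + 2) * (2 * υ * ω / (υ - ω)) ^ k)

lemma weight_ratio_le_momentGrowth (ω υ : ℝ) (hω : 1 ≤ ω) (hυ : ω < υ) (n m k : ℕ) (hmk : m ≤ k)
    (h2 : 2 * m ≤ k + 2) :
    ((2 * (n + m)).factorial : ℝ) * ω ^ (2 * (n + m)) / ((2 * n).factorial * υ ^ (2 * n)) ≤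
      k.factorial * momentGrowth υ ω k := by
  unfold momentGrowth
  have hω0 : 0 < ω := by linarith
  have hυ0 : 0 < υ := by linarith
  have hd : 0 < υ - ω := by linarith
  have hk0 : (0 : ℝ) < k.factorial := by exact_mod_cast k.factorial_pos
  have hn0 : (0 : ℝ) < (2 * n).factorial := by exact_mod_cast (2 * n).factorial_pos
  have hH1 : 1 ≤ υ * ω / (υ - ω) := by
    rw [one_le_div hd]; nlinarith
  set H := υ * ω / (υ - ω) with hH
  have hKH : 2 * υ * ω / (υ - ω) = 2 * H := by rw [hH]; ring
  rw [hKH, mul_add (k.factorial : ℝ), mul_one_div_cancel hk0.ne']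
  rcases m with _ | m
  · have : ((2 * (n + 0)).factorial : ℝ) * ω ^ (2 * (n + 0)) / ((2 * n).factorial * υ ^ (2 * n))
        ≤ 1 := by
      rw [div_le_one (by positivity), add_zero]; gcongr
    refine this.trans (le_add_of_nonneg_right ?_)
    split_ifs <;> positivity
  have hk : k ≠ 0 := by omega
  rw [if_neg hk]
  set x := ω / υ with hx
  have hx0 : 0 < x := by positivity
  have hx1 : x < 1 := (div_lt_one hυ0).2 hυ
  have hb := choose_mul_pow_le (2 * n) (2 * (m + 1)) (by omega) x hx0 hx1
  have hsx : 0 < √x := Real.sqrt_pos.2 hx0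
  have hinv : √(υ / ω) = (√x)⁻¹ := by rw [← Real.sqrt_inv, hx, inv_div]
  rw [hinv]
  rw [← le_div_iff₀ hsx, div_eq_mul_inv] at hb
  have hHx : H * (1 - x) = ω := by rw [hH, hx]; field_simp
  have hfac : ((2 * (n + (m + 1))).factorial : ℝ) = (2 * n + 2 * (m + 1)).choose (2 * n) *
      (2 * n).factorial * (2 * (m + 1)).factorial := by
    rw [show 2 * (n + (m + 1)) = 2 * n + 2 * (m + 1) by ring]
    rw [Nat.choose_symm_add]
    exact_mod_cast (Nat.add_choose_mul_factorial_mul_factorial _ _).symm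
  have heq : ((2 * (n + (m + 1))).factorial : ℝ) * ω ^ (2 * (n + (m + 1))) /
      ((2 * n).factorial * υ ^ (2 * n)) = (2 * (m + 1)).factorial * H ^ (2 * (m + 1)) *
      (((2 * n + 2 * (m + 1)).choose (2 * n) : ℝ) * x ^ (2 * n) * (1 - x) ^ (2 * (m + 1))) := by
    rw [hfac, show 2 * (n + (m + 1)) = 2 * n + 2 * (m + 1) by ring, pow_add ω]
    nth_rw 2 [← hHx]
    rw [mul_pow H, show x ^ (2 * n) = ω ^ (2 * n) / υ ^ (2 * n) from div_pow _ _ _]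
    field_simp
  rw [heq]
  have hf : ((2 * (m + 1)).factorial : ℝ) ≤ (k + 2).factorial := by
    exact_mod_cast Nat.factorial_le (by omega)
  have hp : H ^ (2 * (m + 1)) ≤ H ^ (k + 2) := pow_le_pow_right₀ hH1 (by omega)
  have hF : ((k + 2).factorial : ℝ) = (k + 2) * (k + 1) * k.factorial := by
    rw [Nat.factorial_succ, Nat.factorial_succ]; push_cast; ring
  have h2k : ((k : ℝ) + 1) ≤ 2 ^ k := by exact_mod_cast Nat.lt_two_pow_self
  have hpi := Real.pi_pos
  calc _ ≤ ((k + 2).factorial : ℝ) * H ^ (k + 2) * (2 / Real.pi * (√x)⁻¹) := by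
        have : 0 ≤ 1 - x := by linarith
        gcongr
    _ = (k + 1) * (k.factorial * (k + 2) * H ^ (k + 2) * (2 / Real.pi * (√x)⁻¹)) := by
        rw [hF]; ring
    _ ≤ 2 ^ k * (k.factorial * (k + 2) * H ^ (k + 2) * (2 / Real.pi * (√x)⁻¹)) := by gcongr
    _ = k.factorial * ((2 * H) ^ 2 / (2 * Real.pi) * (√x)⁻¹ * ((k + 2) * (2 * H) ^ k)) := by
        rw [mul_pow, mul_pow]; field_simp; ring
    _ ≤ _ := by linarith


section Dyson

variable {R : Type*} [NormedRing R] [NormedAlgebra ℝ R]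

/-- Left multiplication by `b` combined with a shift of the index by one. -/
def shiftMul (b : R) (Y : ℕ → R) : ℕ → R
  | 0 => 0
  | m + 1 => b * Y m

/-- The coefficients of the Dyson series of `a(s) + b z`, where `z` is a formal variable:
`dysonCoeff a b π t₀ k m t` is the coefficient of `z ^ m` in the `k`-fold iterated integral over
`[t₀, t]`. The map `π` is used to freeze the integrand outside of a given interval. -/
noncomputable def dysonCoeff (a : ℝ → R) (b : R) (π : ℝ → ℝ) (t₀ : ℝ) : ℕ → ℕ → ℝ → R
  | 0 => fun m _ => if m = 0 then 1 else 0
  | k + 1 => fun m t => ∫ s in t₀..t, (a s * dysonCoeff a b π t₀ k m (π s) +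
      shiftMul b (fun i => dysonCoeff a b π t₀ k i (π s)) m)

/-- The derivative of `dysonCoeff a b π t₀ (k + 1) m`. -/
noncomputable def dysonDeriv (a : ℝ → R) (b : R) (π : ℝ → ℝ) (t₀ : ℝ) (k m : ℕ) (s : ℝ) : R :=
  a s * dysonCoeff a b π t₀ k m (π s) + shiftMul b (fun i => dysonCoeff a b π t₀ k i (π s)) m

variable {a : ℝ → R} {b : R} {π : ℝ → ℝ} {t₀ : ℝ}

lemma dysonCoeff_succ (k m : ℕ) (t : ℝ) :
    dysonCoeff a b π t₀ (k + 1) m t = ∫ s in t₀..t, dysonDeriv a b π t₀ k m s := rfl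

lemma dysonCoeff_succ_self (k m : ℕ) : dysonCoeff a b π t₀ (k + 1) m t₀ = 0 := by
  rw [dysonCoeff_succ, integral_same]

lemma continuous_dysonDeriv_of (ha : Continuous a) (hπ : Continuous π) {k : ℕ}
    (h : ∀ m, Continuous (dysonCoeff a b π t₀ k m)) (m : ℕ) :
    Continuous (dysonDeriv a b π t₀ k m) := by
  refine (ha.mul ((h m).comp hπ)).add ?_
  rcases m with _ | m
  · exact continuous_const
  · exact continuous_const.mul ((h m).comp hπ)

lemma continuous_dysonCoeff (ha : Continuous a) (hπ : Continuous π) (k m : ℕ) :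
    Continuous (dysonCoeff a b π t₀ k m) := by
  induction k generalizing m with
  | zero => exact continuous_const
  | succ k ih =>
    exact continuous_primitive
      (fun u v => (continuous_dysonDeriv_of ha hπ ih m).intervalIntegrable u v) t₀

lemma continuous_dysonDeriv (ha : Continuous a) (hπ : Continuous π) (k m : ℕ) :
    Continuous (dysonDeriv a b π t₀ k m) :=
  continuous_dysonDeriv_of ha hπ (continuous_dysonCoeff ha hπ k) m

lemma hasDerivAt_dysonCoeff [CompleteSpace R] (ha : Continuous a) (hπ : Continuous π) (k m : ℕ)
    (t : ℝ) : HasDerivAt (dysonCoeff a b π t₀ (k + 1) m) (dysonDeriv a b π t₀ k m t) t :=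
  (continuous_dysonDeriv ha hπ k m).integral_hasStrictDerivAt t₀ t |>.hasDerivAt

lemma dysonDeriv_eq_zero_of {k m : ℕ}
    (h : ∀ i t, k < i → dysonCoeff a b π t₀ k i t = 0) (hm : k + 1 < m) (s : ℝ) :
    dysonDeriv a b π t₀ k m s = 0 := by
  obtain ⟨i, rfl⟩ : ∃ i, m = i + 1 := ⟨m - 1, by omega⟩
  simp [dysonDeriv, shiftMul, h (i + 1) _ (by omega), h i _ (by omega)]

lemma dysonCoeff_eq_zero {k m : ℕ} (hm : k < m) (t : ℝ) : dysonCoeff a b π t₀ k m t = 0 := by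
  induction k generalizing m t with
  | zero => exact if_neg (by omega)
  | succ k ih =>
    simp [dysonCoeff_succ, dysonDeriv_eq_zero_of (fun i t hi => ih hi t) hm]

lemma sum_norm_dysonDeriv_le {r : ℝ → ℝ} (hr : ∀ s, ‖a s‖ + ‖b‖ ≤ r s) (k : ℕ) (s : ℝ) :
    ∑ m ∈ Finset.range (k + 2), ‖dysonDeriv a b π t₀ k m s‖ ≤
      r s * ∑ m ∈ Finset.range (k + 1), ‖dysonCoeff a b π t₀ k m (π s)‖ := by
  have hA : ∑ m ∈ Finset.range (k + 2), ‖a s * dysonCoeff a b π t₀ k m (π s)‖ ≤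
      ‖a s‖ * ∑ m ∈ Finset.range (k + 1), ‖dysonCoeff a b π t₀ k m (π s)‖ := by
    rw [Finset.sum_range_succ, dysonCoeff_eq_zero (Nat.lt_succ_self k), mul_zero, norm_zero,
      add_zero, Finset.mul_sum]
    exact Finset.sum_le_sum fun m _ => norm_mul_le _ _
  have hB : ∑ m ∈ Finset.range (k + 2),
      ‖shiftMul b (fun i => dysonCoeff a b π t₀ k i (π s)) m‖ ≤
      ‖b‖ * ∑ m ∈ Finset.range (k + 1), ‖dysonCoeff a b π t₀ k m (π s)‖ := by
    rw [Finset.sum_range_succ', Finset.mul_sum]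
    simp only [shiftMul, norm_zero, add_zero]
    exact Finset.sum_le_sum fun m _ => norm_mul_le _ _
  have hS : 0 ≤ ∑ m ∈ Finset.range (k + 1), ‖dysonCoeff a b π t₀ k m (π s)‖ :=
    Finset.sum_nonneg fun _ _ => norm_nonneg _
  calc _ ≤ ∑ m ∈ Finset.range (k + 2), (‖a s * dysonCoeff a b π t₀ k m (π s)‖ +
        ‖shiftMul b (fun i => dysonCoeff a b π t₀ k i (π s)) m‖) :=
        Finset.sum_le_sum fun m _ => norm_add_le _ _
    _ ≤ _ := by
        rw [Finset.sum_add_distrib]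
        nlinarith [mul_le_mul_of_nonneg_right (hr s) hS]

lemma sum_norm_dysonCoeff_le [NormOneClass R] {r : ℝ → ℝ} {t₁ : ℝ} (ha : Continuous a)
    (hπ : Continuous π) (hπI : ∀ s ∈ Set.Icc t₀ t₁, π s = s) (hrc : Continuous r)
    (hr : ∀ s, ‖a s‖ + ‖b‖ ≤ r s) (k : ℕ) {t : ℝ} (ht : t ∈ Set.Icc t₀ t₁) :
    ∑ m ∈ Finset.range (k + 1), ‖dysonCoeff a b π t₀ k m t‖ ≤
      (∫ s in t₀..t, r s) ^ k / k.factorial := by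
  induction k generalizing t with
  | zero => simp [dysonCoeff]
  | succ k ih =>
    have hc : ∀ t, HasDerivAt (fun t => ∫ s in t₀..t, r s) (r t) t := fun t =>
      (hrc.integral_hasStrictDerivAt t₀ t).hasDerivAt
    have hcc : Continuous fun t => ∫ s in t₀..t, r s :=
      continuous_iff_continuousAt.2 fun t => (hc t).continuousAt
    have hD : ∀ m, Continuous fun s => ‖dysonDeriv a b π t₀ k m s‖ := fun m =>
      (continuous_dysonDeriv ha hπ k m).norm
    have hr0 : ∀ s, 0 ≤ r s := fun s =>
      (add_nonneg (norm_nonneg _) (norm_nonneg _)).trans (hr s)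
    have hg : Continuous fun s => r s * ((∫ u in t₀..s, r u) ^ k / k.factorial) := by fun_prop
    have hf : (k.factorial : ℝ) ≠ 0 := by exact_mod_cast k.factorial_ne_zero
    calc _ ≤ ∑ m ∈ Finset.range (k + 2), ∫ s in t₀..t, ‖dysonDeriv a b π t₀ k m s‖ :=
          Finset.sum_le_sum fun m _ => norm_integral_le_integral_norm ht.1
      _ = ∫ s in t₀..t, ∑ m ∈ Finset.range (k + 2), ‖dysonDeriv a b π t₀ k m s‖ :=
          (integral_finsetSum fun m _ => (hD m).intervalIntegrable _ _).symm
      _ ≤ ∫ s in t₀..t, r s * ((∫ u in t₀..s, r u) ^ k / k.factorial) := by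
          refine integral_mono_on ht.1
            ((continuous_finsetSum _ fun m _ => hD m).intervalIntegrable _ _)
            (hg.intervalIntegrable _ _) fun s hs => ?_
          have hsI : s ∈ Set.Icc t₀ t₁ := ⟨hs.1, hs.2.trans ht.2⟩
          refine (sum_norm_dysonDeriv_le hr k s).trans (mul_le_mul_of_nonneg_left ?_ (hr0 s))
          rw [hπI s hsI]
          exact ih hsI
      _ = _ := by
          have hd : ∀ s, HasDerivAt
              (fun s => (∫ u in t₀..s, r u) ^ (k + 1) / ((k + 1).factorial : ℝ))
              (r s * ((∫ u in t₀..s, r u) ^ k / k.factorial)) s := fun s => by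
            refine (((hc s).fun_pow (k + 1)).div_const ((k + 1).factorial : ℝ)).congr_deriv ?_
            rw [Nat.factorial_succ]; push_cast
            field_simp
          rw [integral_eq_sub_of_hasDerivAt (fun s _ => hd s) (hg.intervalIntegrable _ _)]
          simp

end Dyson

section WeightedShift

variable {E : Type*} [NormedAddCommGroup E]

lemma memℓp_of_norm_le_shift {p : ℝ≥0∞} (hp : 0 < p.toReal) (f : lp (fun _ : ℕ => E) p) {g : ℕ → E}
    (m : ℕ) {c : ℝ} (h : ∀ n, ‖g n‖ ≤ c * ‖f (n + m)‖) :
    Memℓp g p := by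
  have hs := (lp.memℓp f).summable hp
  refine memℓp_gen (Summable.of_nonneg_of_le (fun n => by positivity) (fun n => ?_)
    (((summable_nat_add_iff m).2 hs).mul_left (|c| ^ p.toReal)))
  rw [← Real.mul_rpow (abs_nonneg _) (norm_nonneg _)]
  have := (h n).trans (mul_le_mul_of_nonneg_right (le_abs_self c) (norm_nonneg _))
  gcongr

lemma norm_le_of_norm_le_shift {p : ℝ≥0∞} (hp : 0 < p.toReal) (f g : lp (fun _ : ℕ => E) p)
    (m : ℕ) {c : ℝ} (hc : 0 ≤ c) (h : ∀ n, ‖g n‖ ≤ c * ‖f (n + m)‖) : ‖g‖ ≤ c * ‖f‖ := by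
  refine lp.norm_le_of_tsum_le hp (mul_nonneg hc (lp.norm_nonneg' f)) ?_
  have hs := (lp.memℓp f).summable hp
  have hsm := (summable_nat_add_iff m).2 hs
  rw [Real.mul_rpow hc (lp.norm_nonneg' f), lp.norm_rpow_eq_tsum hp]
  have hle : ∀ n, ‖g n‖ ^ p.toReal ≤ c ^ p.toReal * ‖f (n + m)‖ ^ p.toReal := fun n => by
    rw [← Real.mul_rpow hc (norm_nonneg _)]
    have := h n
    gcongr
  calc _ ≤ ∑' n, c ^ p.toReal * ‖f (n + m)‖ ^ p.toReal :=
        ((lp.memℓp g).summable hp).tsum_le_tsum hle (hsm.mul_left _)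
    _ ≤ _ := by
        rw [tsum_mul_left]
        refine mul_le_mul_of_nonneg_left ?_ (by positivity)
        exact tsum_comp_le_tsum_of_inj hs (fun _ => by positivity) (add_left_injective m)

variable [NormedSpace ℝ E]

/-- The weighted shift of an element `f` of `ℓ^p`, acted on pointwise by a continuous linear map `L`,
as a continuous linear function of `L`. -/
noncomputable def weightedShift {p : ℝ≥0∞} [Fact (1 ≤ p)] (hp : 0 < p.toReal)
    (f : lp (fun _ : ℕ => E) p) (m : ℕ) (κ : ℕ → ℝ) (c : ℝ) (hκ : ∀ n, |κ n| ≤ c) :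
    (E →L[ℝ] E) →L[ℝ] lp (fun _ : ℕ => E) p :=
  have h : ∀ (L : E →L[ℝ] E) n, ‖κ n • L (f (n + m))‖ ≤ c * ‖L‖ * ‖f (n + m)‖ := fun L n => by
    rw [norm_smul, Real.norm_eq_abs, mul_assoc]
    exact mul_le_mul (hκ n) (L.le_opNorm _) (norm_nonneg _) ((abs_nonneg _).trans (hκ n))
  LinearMap.mkContinuous
    { toFun := fun L => ⟨fun n => κ n • L (f (n + m)), memℓp_of_norm_le_shift hp f m (h L)⟩
      map_add' := fun L L' => by ext1; funext n; exact smul_add _ _ _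
      map_smul' := fun r L => by ext1; funext n; exact smul_comm _ _ _ }
    (c * ‖f‖) fun L => by
      have hc : 0 ≤ c := (abs_nonneg _).trans (hκ 0)
      refine (norm_le_of_norm_le_shift hp f _ m (mul_nonneg hc (norm_nonneg L)) (h L)).trans_eq ?_
      ring

lemma weightedShift_apply {p : ℝ≥0∞} [Fact (1 ≤ p)] (hp : 0 < p.toReal)
    (f : lp (fun _ : ℕ => E) p) (m : ℕ) (κ : ℕ → ℝ) (c : ℝ) (hκ : ∀ n, |κ n| ≤ c)
    (L : E →L[ℝ] E) (n : ℕ) : weightedShift hp f m κ c hκ L n = κ n • L (f (n + m)) := rfl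

lemma norm_weightedShift_le {p : ℝ≥0∞} [Fact (1 ≤ p)] (hp : 0 < p.toReal)
    (f : lp (fun _ : ℕ => E) p) (m : ℕ) (κ : ℕ → ℝ) (c : ℝ) (hκ : ∀ n, |κ n| ≤ c) {c' : ℝ}
    (hκ' : ∀ n, |κ n| ≤ c') (L : E →L[ℝ] E) :
    ‖weightedShift hp f m κ c hκ L‖ ≤ c' * ‖L‖ * ‖f‖ := by
  have hc : 0 ≤ c' := (abs_nonneg _).trans (hκ' 0)
  refine norm_le_of_norm_le_shift hp f _ m (mul_nonneg hc (norm_nonneg L)) fun n => ?_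
  rw [weightedShift_apply, norm_smul, Real.norm_eq_abs, mul_assoc]
  exact mul_le_mul (hκ' n) (L.le_opNorm _) (norm_nonneg _) hc

end WeightedShift

section MomentDynamics

/-- The matrix `matA v` as a continuous linear map. -/
noncomputable def momentA (v : ℝ) : (Fin 3 → ℝ) →L[ℝ] (Fin 3 → ℝ) :=
  (matA v).mulVecLin.toContinuousLinearMap

/-- The matrix `matB` as a continuous linear map. -/
noncomputable def momentB : (Fin 3 → ℝ) →L[ℝ] (Fin 3 → ℝ) :=
  matB.mulVecLin.toContinuousLinearMap

lemma momentA_apply (v : ℝ) (x : Fin 3 → ℝ) : momentA v x = (matA v).mulVec x := rfl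

lemma momentB_apply (x : Fin 3 → ℝ) : momentB x = matB.mulVec x := rfl

lemma matA_mulVec (v : ℝ) (x : Fin 3 → ℝ) :
    (matA v).mulVec x = ![2 * x 1, -v * x 0 + x 2, -2 * v * x 1] := by
  ext i
  fin_cases i <;> simp [matA, Matrix.mulVec, dotProduct, Fin.sum_univ_three]

lemma matB_mulVec (x : Fin 3 → ℝ) : matB.mulVec x = ![0, x 0, 2 * x 1] := by
  ext i
  fin_cases i <;> simp [matB, Matrix.mulVec, dotProduct, Fin.sum_univ_three]

lemma continuous_momentA : Continuous momentA := by
  refine continuous_clm_apply.2 fun x => continuous_pi fun i => ?_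
  simp only [momentA_apply, matA_mulVec]
  fin_cases i <;> simp <;> fun_prop

lemma norm_momentA_le (v : ℝ) : ‖momentA v‖ ≤ 2 * √(1 + v ^ 2) := by
  refine ContinuousLinearMap.opNorm_le_bound _ (by positivity) fun x => ?_
  have h1 : 1 ≤ √(1 + v ^ 2) := Real.one_le_sqrt.2 (by nlinarith [sq_nonneg v])
  have hv : |v| ≤ √(1 + v ^ 2) := Real.abs_le_sqrt (by linarith)
  have hx : ∀ i, |x i| ≤ ‖x‖ := fun i => norm_le_pi_norm x i
  rw [pi_norm_le_iff_of_nonneg (by positivity), momentA_apply, matA_mulVec]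
  intro i
  fin_cases i <;> simp only [Fin.zero_eta, Fin.mk_one, Fin.reduceFinMk, Matrix.cons_val,
    Matrix.cons_val_zero, Matrix.cons_val_one, Real.norm_eq_abs]
  · rw [abs_mul, abs_two]
    gcongr
    · linarith
    · exact hx 1
  · refine (abs_add_le _ _).trans ?_
    rw [abs_mul, abs_neg, two_mul, add_mul]
    gcongr
    · exact hx 0
    · exact (hx 2).trans (le_mul_of_one_le_left (norm_nonneg _) h1)
  · rw [abs_mul, abs_mul, abs_neg, abs_two]
    gcongr
    exact hx 1

lemma norm_momentB_le : ‖momentB‖ ≤ 2 := by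
  refine ContinuousLinearMap.opNorm_le_bound _ (by positivity) fun x => ?_
  have hx : ∀ i, |x i| ≤ ‖x‖ := fun i => norm_le_pi_norm x i
  rw [pi_norm_le_iff_of_nonneg (by positivity), momentB_apply, matB_mulVec]
  intro i
  fin_cases i <;> simp only [Fin.zero_eta, Fin.mk_one, Fin.reduceFinMk, Matrix.cons_val,
    Matrix.cons_val_zero, Matrix.cons_val_one, Real.norm_eq_abs]
  · simp
  · linarith [hx 0, norm_nonneg x]
  · rw [abs_mul, abs_two]
    gcongr
    exact hx 1

variable {W π : ℝ → ℝ} {t₀ : ℝ}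

lemma dysonDeriv_moment_apply_eq_zero_of {k : ℕ}
    (h : ∀ m t x, ∀ j : Fin 3, k + j < 2 * m →
      dysonCoeff (fun s => momentA (W s)) momentB π t₀ k m t x j = 0)
    (m : ℕ) (s : ℝ) (x : Fin 3 → ℝ) (j : Fin 3) (hj : k + 1 + j < 2 * m) :
    dysonDeriv (fun s => momentA (W s)) momentB π t₀ k m s x j = 0 := by
  obtain ⟨i, rfl⟩ : ∃ i, m = i + 1 := ⟨m - 1, by omega⟩
  change momentA (W s) (dysonCoeff (fun s => momentA (W s)) momentB π t₀ k (i + 1) (π s) x) j +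
    momentB (dysonCoeff (fun s => momentA (W s)) momentB π t₀ k i (π s) x) j = 0
  rw [momentA_apply, momentB_apply, matA_mulVec, matB_mulVec]
  fin_cases j <;> simp only [Fin.zero_eta, Fin.mk_one, Fin.reduceFinMk, Matrix.cons_val,
    Matrix.cons_val_zero, Matrix.cons_val_one] at hj ⊢
  · rw [h _ _ _ 1 (by simp only [Fin.val_one]; omega)]; ring
  · rw [h _ _ _ 0 (by simp only [Fin.val_zero]; omega),
      h _ _ _ 2 (by simp only [Fin.val_two]; omega),
      h _ _ _ 0 (by simp only [Fin.val_zero]; omega)]; ring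
  · rw [h _ _ _ 1 (by simp only [Fin.val_one]; omega),
      h _ _ _ 1 (by simp only [Fin.val_one]; omega)]; ring

lemma dysonCoeff_moment_apply_eq_zero (hW : Continuous W) (hπ : Continuous π) (k m : ℕ) (t : ℝ)
    (x : Fin 3 → ℝ) (j : Fin 3) (hj : k + j < 2 * m) :
    dysonCoeff (fun s => momentA (W s)) momentB π t₀ k m t x j = 0 := by
  induction k generalizing m t x j with
  | zero => simp [dysonCoeff, show m ≠ 0 by omega]
  | succ k ih =>
    have hc := (continuous_dysonDeriv (b := momentB) (t₀ := t₀) (continuous_momentA.comp hW) hπ k m)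
    have := ((ContinuousLinearMap.proj (R := ℝ) (φ := fun _ : Fin 3 => ℝ) j).comp
      (ContinuousLinearMap.apply ℝ (Fin 3 → ℝ) x)).intervalIntegral_comp_comm
      (hc.intervalIntegrable (μ := volume) t₀ t)
    rw [dysonCoeff_succ]
    refine this.symm.trans ((integral_congr (g := fun _ => (0 : ℝ)) fun s _ => ?_).trans (by simp))
    exact dysonDeriv_moment_apply_eq_zero_of ih m s x j hj

lemma dysonCoeff_moment_eq_zero (hW : Continuous W) (hπ : Continuous π) {k m : ℕ}
    (hm : k + 2 < 2 * m) (t : ℝ) :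
    dysonCoeff (fun s => momentA (W s)) momentB π t₀ k m t = 0 := by
  ext x j
  exact dysonCoeff_moment_apply_eq_zero hW hπ k m t x j (by omega)

lemma dysonDeriv_moment_eq_zero (hW : Continuous W) (hπ : Continuous π) {k m : ℕ}
    (hm : k + 1 + 2 < 2 * m) (t : ℝ) :
    dysonDeriv (fun s => momentA (W s)) momentB π t₀ k m t = 0 := by
  ext x j
  exact dysonDeriv_moment_apply_eq_zero_of (dysonCoeff_moment_apply_eq_zero hW hπ k) m t x j
    (by omega)

lemma hasSum_ite_add_two_mul_geometric {y : ℝ} (hy : |y| < 1) :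
    HasSum (fun k : ℕ => if k = 0 then 0 else ((k : ℝ) + 2) * y ^ k)
      (y * (3 - 2 * y) / (1 - y) ^ 2) := by
  have h1 := hasSum_coe_mul_geometric_of_norm_lt_one (𝕜 := ℝ) hy
  have h2 := (hasSum_geometric_of_abs_lt_one hy).mul_left 2
  have hne : 1 - y ≠ 0 := by linarith [(abs_lt.1 hy).2]
  have h := (h1.add h2).sub (hasSum_ite_eq (0 : ℕ) (2 : ℝ))
  convert! h using 1
  · funext k
    rcases eq_or_ne k 0 with rfl | hk
    · simp
    · simp [hk]; ring
  · field_simp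
    ring

lemma hasSum_pow_mul_momentGrowth {υ ω c : ℝ} (hc : |c * (2 * υ * ω / (υ - ω))| < 1) :
    HasSum (fun k => c ^ k * momentGrowth υ ω k)
      (Real.exp c + (c * (2 * υ * ω / (υ - ω)) ^ 3 / (2 * Real.pi)) * √(υ / ω)
        * (3 - 2 * c * (2 * υ * ω / (υ - ω))) / (1 - c * (2 * υ * ω / (υ - ω))) ^ 2) := by
  have h1 : HasSum (fun k : ℕ => c ^ k / k.factorial) (Real.exp c) := by
    rw [Real.exp_eq_exp_ℝ]
    exact NormedSpace.expSeries_div_hasSum_exp c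
  have h2 := (hasSum_ite_add_two_mul_geometric hc).mul_left
    ((2 * υ * ω / (υ - ω)) ^ 2 / (2 * Real.pi) * √(υ / ω))
  convert h1.add h2 using 1
  · funext k
    unfold momentGrowth
    split_ifs
    · simp [*]
    · rw [mul_pow]; ring
  · ring

lemma momentGrowth_nonneg {υ ω : ℝ} (hω : 1 ≤ ω) (hυ : ω < υ) (k : ℕ) :
    0 ≤ momentGrowth υ ω k := by
  have hω0 : 0 < ω := by linarith
  have hυ0 : 0 < υ := by linarith
  have hd : 0 < υ - ω := by linarith
  have hpi := Real.pi_pos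
  unfold momentGrowth
  split_ifs <;> positivity

lemma summable_coe_mul_momentGrowth {υ ω c : ℝ} (hc : |c * (2 * υ * ω / (υ - ω))| < 1) :
    Summable fun k : ℕ => (k : ℝ) * momentGrowth υ ω k * c ^ (k - 1) := by
  rw [← summable_nat_add_iff 1]
  set K := 2 * υ * ω / (υ - ω) with hK
  have h1 : Summable fun k : ℕ => c ^ k / k.factorial := Real.summable_pow_div_factorial c
  have h2 := summable_pow_mul_geometric_of_norm_lt_one (R := ℝ) 2 hc
  have h3 := summable_pow_mul_geometric_of_norm_lt_one (R := ℝ) 1 hc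
  have h4 := summable_pow_mul_geometric_of_norm_lt_one (R := ℝ) 0 hc
  refine (h1.add (((h2.add (h3.mul_left 4)).add (h4.mul_left 3)).mul_left
    (K ^ 2 / (2 * Real.pi) * √(υ / ω) * K))).congr fun k => ?_
  have hf : (k.factorial : ℝ) ≠ 0 := by exact_mod_cast k.factorial_ne_zero
  rw [momentGrowth, if_neg (Nat.succ_ne_zero k), Nat.factorial_succ, Nat.add_sub_cancel, ← hK,
    mul_pow]
  push_cast
  have : (1 : ℝ) / ((k + 1) * k.factorial) = (1 / k.factorial) * (k + 1 : ℝ)⁻¹ := by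
    field_simp
  have hk : (k + 1 : ℝ) * (k + 1 : ℝ)⁻¹ = 1 := mul_inv_cancel₀ (by positivity)
  rw [this]
  linear_combination (-(1 / (k.factorial : ℝ)) * c ^ k) * hk

/-- The weight `(2n)! ω^(2n)`. -/
noncomputable def momentWeight (ω : ℝ) (n : ℕ) : ℝ := ((2 * n).factorial : ℝ) * ω ^ (2 * n)

lemma momentWeight_pos {ω : ℝ} (hω : 0 < ω) (n : ℕ) : 0 < momentWeight ω n :=
  mul_pos (by exact_mod_cast Nat.factorial_pos _) (by positivity)

lemma abs_momentWeight_div_le {υ ω : ℝ} (hω : 1 ≤ ω) (hυ : ω < υ) {m k : ℕ} (hmk : m ≤ k)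
    (h2 : 2 * m ≤ k + 2) (n : ℕ) :
    |momentWeight ω (n + m) / momentWeight υ n| ≤ k.factorial * momentGrowth υ ω k := by
  rw [abs_of_nonneg (div_nonneg (momentWeight_pos (by linarith) _).le
    (momentWeight_pos (by linarith) _).le)]
  exact weight_ratio_le_momentGrowth ω υ hω hυ n m k hmk h2

variable {p : ℝ≥0∞} [Fact (1 ≤ p)] {υ ω : ℝ}

/-- The shift by `m` on moment sequences, expressed through weighted representatives: it maps the
representative of a sequence for the weight `momentWeight ω` to a representative for the weight
`momentWeight υ`, with a continuous linear map acting on all the entries. -/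
noncomputable def momentShift (hp : 0 < p.toReal) (hω : 1 ≤ ω) (hυ : ω < υ)
    (f : lp (fun _ : ℕ => Fin 3 → ℝ) p) (m : ℕ) :
    ((Fin 3 → ℝ) →L[ℝ] (Fin 3 → ℝ)) →L[ℝ] lp (fun _ : ℕ => Fin 3 → ℝ) p :=
  weightedShift hp f m (fun n => momentWeight ω (n + m) / momentWeight υ n) _
    (abs_momentWeight_div_le hω hυ (k := 2 * m) (by omega) (by omega))

lemma norm_sum_momentShift_le (hp : 0 < p.toReal) (hω : 1 ≤ ω) (hυ : ω < υ)
    (f : lp (fun _ : ℕ => Fin 3 → ℝ) p) (k : ℕ) (Y : ℕ → (Fin 3 → ℝ) →L[ℝ] (Fin 3 → ℝ))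
    (hY : ∀ m, k + 2 < 2 * m → Y m = 0) {S : ℝ}
    (hS : ∑ m ∈ Finset.range (k + 1), ‖Y m‖ ≤ S) :
    ‖∑ m ∈ Finset.range (k + 1), momentShift hp hω hυ f m (Y m)‖ ≤
      k.factorial * momentGrowth υ ω k * S * ‖f‖ := by
  have hg := momentGrowth_nonneg hω hυ k
  calc _ ≤ ∑ m ∈ Finset.range (k + 1), k.factorial * momentGrowth υ ω k * ‖Y m‖ * ‖f‖ := by
        refine norm_sum_le_of_le _ fun m hm => ?_
        by_cases h : k + 2 < 2 * m
        · simp [hY m h]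
        · exact norm_weightedShift_le _ _ _ _ _ _
            (abs_momentWeight_div_le hω hυ (by grind) (by omega)) _
    _ = k.factorial * momentGrowth υ ω k * (∑ m ∈ Finset.range (k + 1), ‖Y m‖) * ‖f‖ := by
        rw [Finset.mul_sum, Finset.sum_mul]
    _ ≤ _ := by gcongr

lemma smul_sum_momentShift_apply (hp : 0 < p.toReal) (hω : 1 ≤ ω) (hυ : ω < υ)
    (f : lp (fun _ : ℕ => Fin 3 → ℝ) p) (s : Finset ℕ)
    (Y : ℕ → (Fin 3 → ℝ) →L[ℝ] (Fin 3 → ℝ)) (n : ℕ) :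
    momentWeight υ n • (∑ m ∈ s, momentShift hp hω hυ f m (Y m)) n =
      ∑ m ∈ s, momentWeight ω (n + m) • Y m (f (n + m)) := by
  have hv := (momentWeight_pos (show 0 < υ by linarith) n).ne'
  rw [lp.coeFn_sum, Finset.sum_apply, Finset.smul_sum]
  refine Finset.sum_congr rfl fun m _ => ?_
  rw [momentShift, weightedShift_apply, smul_smul, mul_div_cancel₀ _ hv]

lemma sum_smul_dysonDeriv_apply {a : ℝ → (Fin 3 → ℝ) →L[ℝ] (Fin 3 → ℝ)}
    {b : (Fin 3 → ℝ) →L[ℝ] (Fin 3 → ℝ)} (w : ℕ → ℝ) (f : ℕ → Fin 3 → ℝ) (k n : ℕ) {s : ℝ}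
    (hs : π s = s) :
    ∑ m ∈ Finset.range (k + 2), w (n + m) • dysonDeriv a b π t₀ k m s (f (n + m)) =
      a s (∑ m ∈ Finset.range (k + 1), w (n + m) • dysonCoeff a b π t₀ k m s (f (n + m))) +
      b (∑ m ∈ Finset.range (k + 1),
        w (n + 1 + m) • dysonCoeff a b π t₀ k m s (f (n + 1 + m))) := by
  simp only [dysonDeriv, hs, add_apply, smul_add, Finset.sum_add_distrib]
  congr 1
  · rw [Finset.sum_range_succ, dysonCoeff_eq_zero (Nat.lt_succ_self k), map_sum]
    simp
  · rw [Finset.sum_range_succ', map_sum]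
    simp [shiftMul, add_assoc, add_comm 1]

end MomentDynamics

/-- Theorem 4.14 of the paper. For factorially growing weights
`w n = (2n)!·ω^(2n)`, `v n = (2n)!·υ^(2n)` with `υ > ω ≥ 1`, if
`C₀(τ₁,τ₀)·K < 1` with `K = 2υω/(υ−ω)`, then for every initial datum in `ℓ^p(w;ℝ³)`
there is a solution `M : [τ₀,τ₁] → ℓ^p(v;ℝ³)` of the moment dynamics with the stated
norm bound and strong continuity at `τ₀`.  Elements of `ℓ^p(u;ℝ³)` are represented by
`u`-weighted representatives in `lp`: `M0` represents the initial moment sequence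
`n ↦ ((2n)!·ω^(2n)) • M0 n` (so `‖M0‖` is its `‖·‖_{p,w}`-norm), and `F τ` represents
the moment sequence `n ↦ ((2n)!·υ^(2n)) • (F τ) n` (so `‖F τ‖` is its `‖·‖_{p,v}`-norm). -/
theorem moment_dynamics_factorial_weights
    (p : ℝ≥0∞) [Fact (1 ≤ p)] (hp : p ≠ ∞) (υ ω : ℝ) (hω : 1 ≤ ω) (hυ : ω < υ)
    (τ₀ τ₁ : ℝ) (hτ : τ₀ ≤ τ₁) (V : ℝ → ℝ) (hV : ContinuousOn V (Set.Icc τ₀ τ₁))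
    (hK : C₀ V τ₁ τ₀ * (2 * υ * ω / (υ - ω)) < 1)
    (M0 : lp (fun _ : ℕ => Fin 3 → ℝ) p) :
    ∃ F F' : ℝ → lp (fun _ : ℕ => Fin 3 → ℝ) p,
      (∀ n : ℕ, ((Nat.factorial (2 * n) : ℝ) * υ ^ (2 * n)) • (F τ₀) n
          = ((Nat.factorial (2 * n) : ℝ) * ω ^ (2 * n)) • M0 n) ∧
      (∀ τ ∈ Set.Icc τ₀ τ₁, HasDerivWithinAt F (F' τ) (Set.Icc τ₀ τ₁) τ) ∧
      (∀ τ ∈ Set.Icc τ₀ τ₁, ∀ n : ℕ,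
        ((Nat.factorial (2 * n) : ℝ) * υ ^ (2 * n)) • (F' τ) n
          = (matA (V τ)).mulVec (((Nat.factorial (2 * n) : ℝ) * υ ^ (2 * n)) • (F τ) n)
            + matB.mulVec
              (((Nat.factorial (2 * (n + 1)) : ℝ) * υ ^ (2 * (n + 1))) • (F τ) (n + 1))) ∧
      (∀ τ ∈ Set.Icc τ₀ τ₁,
        ‖F τ‖ ≤ (Real.exp (C₀ V τ τ₀)
          + (C₀ V τ τ₀ * (2 * υ * ω / (υ - ω)) ^ 3 / (2 * Real.pi))
            * Real.sqrt (υ / ω)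
            * (3 - 2 * C₀ V τ τ₀ * (2 * υ * ω / (υ - ω)))
              / (1 - C₀ V τ τ₀ * (2 * υ * ω / (υ - ω))) ^ 2) * ‖M0‖) ∧
      Filter.Tendsto (fun τ => ‖F τ - F τ₀‖)
        (nhdsWithin τ₀ (Set.Icc τ₀ τ₁)) (nhds 0) := by
  have hp0 : 0 < p.toReal :=
    ENNReal.toReal_pos (zero_lt_one.trans_le (Fact.out : 1 ≤ p)).ne' hp
  have hKpos : 0 < 2 * υ * ω / (υ - ω) :=
    div_pos (mul_pos (by linarith) (by linarith)) (by linarith)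
  set K := 2 * υ * ω / (υ - ω) with hKdef
  set π : ℝ → ℝ := fun s => Set.projIcc τ₀ τ₁ hτ s with hπdef
  have hπ : Continuous π := continuous_subtype_val.comp continuous_projIcc
  have hπmem : ∀ s, π s ∈ Set.Icc τ₀ τ₁ := fun s => (Set.projIcc τ₀ τ₁ hτ s).2
  have hπI : ∀ s ∈ Set.Icc τ₀ τ₁, π s = s := fun s hs => by
    simp only [hπdef, Set.projIcc_of_mem hτ hs]
  set W : ℝ → ℝ := fun s => V (π s) with hWdef
  have hW : Continuous W := hV.comp_continuous hπ hπmem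
  set r : ℝ → ℝ := fun s => 2 + 2 * √(1 + W s ^ 2) with hrdef
  have hrc : Continuous r := by fun_prop
  have hr : ∀ s, ‖momentA (W s)‖ + ‖momentB‖ ≤ r s := fun s => by
    linarith [norm_momentA_le (W s), norm_momentB_le]
  have hr0 : ∀ s, 0 ≤ r s := fun s => by positivity
  obtain ⟨R, hR⟩ : ∃ R, ∀ s, r s ≤ R := by
    obtain ⟨R, hR⟩ := (isCompact_Icc (a := τ₀) (b := τ₁)).bddAbove_image hrc.continuousOn
    refine ⟨R, fun s => ?_⟩
    have := hR (Set.mem_image_of_mem r (hπmem s))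
    simpa only [hrdef, hWdef, hπI _ (hπmem s)] using this
  have hR0 : 0 ≤ R := (hr0 0).trans (hR 0)
  have hC : ∀ τ ∈ Set.Icc τ₀ τ₁, ∫ s in τ₀..τ, r s = C₀ V τ τ₀ := fun τ hτI => by
    have hi : Continuous fun s => √(1 + W s ^ 2) := by fun_prop
    simp only [hrdef, C₀]
    rw [integral_add (by simp) ((hi.const_mul 2).intervalIntegrable _ _),
      intervalIntegral.integral_const, intervalIntegral.integral_const_mul, smul_eq_mul, mul_comm]
    congr 2
    refine integral_congr fun s hs => ?_
    rw [Set.uIcc_of_le hτI.1] at hs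
    simp only [hWdef, hπI s ⟨hs.1, hs.2.trans hτI.2⟩]
  have hC0 : ∀ τ ∈ Set.Icc τ₀ τ₁, 0 ≤ C₀ V τ τ₀ := fun τ hτI => by
    rw [← hC τ hτI]
    exact integral_nonneg hτI.1 fun s _ => hr0 s
  have hC1 : ∀ τ ∈ Set.Icc τ₀ τ₁, C₀ V τ τ₀ ≤ C₀ V τ₁ τ₀ := fun τ hτI => by
    rw [← hC τ hτI, ← hC τ₁ (Set.right_mem_Icc.2 hτ)]
    exact integral_mono_interval le_rfl hτI.1 hτI.2 (Filter.Eventually.of_forall hr0)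
      (hrc.intervalIntegrable _ _)
  have hCK : ∀ τ ∈ Set.Icc τ₀ τ₁, |C₀ V τ τ₀ * K| < 1 := fun τ hτI => by
    rw [abs_of_nonneg (mul_nonneg (hC0 τ hτI) hKpos.le)]
    exact (mul_le_mul_of_nonneg_right (hC1 τ hτI) hKpos.le).trans_lt hK
  have hac : Continuous fun s => momentA (W s) := continuous_momentA.comp hW
  set X := dysonCoeff (fun s => momentA (W s)) momentB π τ₀ with hX
  set X' := dysonDeriv (fun s => momentA (W s)) momentB π τ₀ with hX'
  set Ψ := momentShift hp0 hω hυ M0 with hΨ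
  set f : ℕ → ℝ → lp (fun _ : ℕ => Fin 3 → ℝ) p := fun k τ =>
    ∑ m ∈ Finset.range (k + 1), Ψ m (X k m τ) with hf
  set f' : ℕ → ℝ → lp (fun _ : ℕ => Fin 3 → ℝ) p := fun k τ =>
    match k with
    | 0 => 0
    | k + 1 => ∑ m ∈ Finset.range (k + 2), Ψ m (X' k m τ) with hf'
  have hXsum : ∀ k, ∀ τ ∈ Set.Icc τ₀ τ₁, ∑ m ∈ Finset.range (k + 1), ‖X k m τ‖ ≤
      C₀ V τ τ₀ ^ k / k.factorial := fun k τ hτI => by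
    rw [← hC τ hτI]
    exact sum_norm_dysonCoeff_le hac hπ hπI hrc hr k hτI
  have hfderiv : ∀ k τ, HasDerivAt (f k) (f' k τ) τ := by
    rintro (_ | k) τ
    · exact hasDerivAt_const τ (f 0 τ)
    · exact HasDerivAt.fun_sum fun m _ =>
        (Ψ m).hasFDerivAt.comp_hasDerivAt τ (hasDerivAt_dysonCoeff hac hπ k m τ)
  have hfbound : ∀ k, ∀ τ ∈ Set.Icc τ₀ τ₁,
      ‖f k τ‖ ≤ C₀ V τ τ₀ ^ k * momentGrowth υ ω k * ‖M0‖ := fun k τ hτI => by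
    refine (norm_sum_momentShift_le hp0 hω hυ M0 k (fun m => X k m τ)
      (fun m hm => dysonCoeff_moment_eq_zero hW hπ hm τ) (hXsum k τ hτI)).trans_eq ?_
    have : (k.factorial : ℝ) ≠ 0 := by exact_mod_cast k.factorial_ne_zero
    field_simp
  set u : ℕ → ℝ := fun k =>
    (k : ℝ) * momentGrowth υ ω k * C₀ V τ₁ τ₀ ^ (k - 1) * (R * ‖M0‖) with hu
  have husum : Summable u :=
    (summable_coe_mul_momentGrowth (hCK τ₁ (Set.right_mem_Icc.2 hτ))).mul_right _
  have hf'bound : ∀ k τ, ‖f' k τ‖ ≤ u k := by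
    rintro (_ | k) τ
    · simp [hf', hu]
    have hk : (k.factorial : ℝ) ≠ 0 := by exact_mod_cast k.factorial_ne_zero
    have hsum : ∑ m ∈ Finset.range (k + 2), ‖X' k m τ‖ ≤
        R * (C₀ V τ₁ τ₀ ^ k / k.factorial) := by
      refine (sum_norm_dysonDeriv_le hr k τ).trans (mul_le_mul (hR τ) ?_
        (Finset.sum_nonneg fun _ _ => norm_nonneg _) hR0)
      refine (hXsum k _ (hπmem τ)).trans ?_
      have := hC1 _ (hπmem τ)
      have := hC0 _ (hπmem τ)
      gcongr
    refine (norm_sum_momentShift_le hp0 hω hυ M0 (k + 1) (fun m => X' k m τ)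
      (fun m hm => dysonDeriv_moment_eq_zero hW hπ hm τ) hsum).trans_eq ?_
    simp only [hu, Nat.factorial_succ, Nat.add_sub_cancel]
    push_cast
    field_simp
  have hfτ₀ : ∀ k, k ≠ 0 → f k τ₀ = 0 := by
    rintro (_ | k) hk
    · exact absurd rfl hk
    · exact Finset.sum_eq_zero fun m _ => by rw [hX, dysonCoeff_succ_self, map_zero]
  have hderiv : ∀ τ, HasDerivAt (fun τ => ∑' k, f k τ) (∑' k, f' k τ) τ :=
    hasDerivAt_tsum husum hfderiv hf'bound (y₀ := τ₀)
      (summable_of_ne_finset_zero (s := {0}) fun k hk => hfτ₀ k (by simpa using hk))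
  have hsolsum := fun τ (hτI : τ ∈ Set.Icc τ₀ τ₁) =>
    (hasSum_pow_mul_momentGrowth (υ := υ) (ω := ω) (hCK τ hτI)).mul_right ‖M0‖
  refine ⟨fun τ => ∑' k, f k τ, fun τ => ∑' k, f' k τ, fun n => ?_,
    fun τ _ => (hderiv τ).hasDerivWithinAt, fun τ hτI n => ?_, fun τ hτI => ?_, ?_⟩
  · have h0 : ∑' k, f k τ₀ = f 0 τ₀ := tsum_eq_single 0 hfτ₀
    change momentWeight υ n • (∑' k, f k τ₀ : lp (fun _ : ℕ => Fin 3 → ℝ) p) n =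
      momentWeight ω n • M0 n
    rw [h0, hf, smul_sum_momentShift_apply]
    simp [hX, dysonCoeff]
  · have hF : HasSum (fun k => f k τ) (∑' k, f k τ) :=
      (Summable.of_norm_bounded (hsolsum τ hτI).summable fun k => hfbound k τ hτI).hasSum
    have hF' : HasSum (fun k => f' k τ) (∑' k, f' k τ) :=
      (Summable.of_norm_bounded husum fun k => hf'bound k τ).hasSum
    have heval : ∀ {g : ℕ → lp (fun _ : ℕ => Fin 3 → ℝ) p} {G} (_ : HasSum g G) (n : ℕ),
        HasSum (fun k => momentWeight υ n • g k n) (momentWeight υ n • G n) := fun hg n =>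
      ((lp.evalCLM ℝ (fun _ : ℕ => Fin 3 → ℝ) p n).hasSum hg).const_smul _
    have hl := heval ((hasSum_nat_add_iff' 1).2 hF') n
    rw [Finset.sum_range_one, show f' 0 τ = 0 from rfl, sub_zero] at hl
    refine hl.unique ?_
    refine (((momentA (V τ)).hasSum (heval hF n)).add
      (momentB.hasSum (heval hF (n + 1)))).congr_fun fun k => ?_
    simp only [hf, hf', hΨ, smul_sum_momentShift_apply]
    rw [hX', sum_smul_dysonDeriv_apply _ _ _ _ (hπI τ hτI)]
    simp only [hWdef, hπI τ hτI, hX]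
  · exact tsum_of_norm_bounded (hsolsum τ hτI) fun k => hfbound k τ hτI
  · exact tendsto_iff_norm_sub_tendsto_zero.1 (hderiv τ₀).continuousAt.continuousWithinAt
end

section
/- Let p ∈ [1,∞), c, ω > 0, w_n = c·ωⁿ, I ⊆ ℝ an interval, τ₀ ∈ I, and suppose V : I → ℝ is l-times continuously differentiable for some l ∈ ℕ. Then the unique continuously differentiable solution M : I → ℓ^p(w;ℝ³) of the moment ODE (∂_τ M(τ))_n = A(τ)·M(τ)_n + B·M(τ)_{n+1} with given initial value M(τ₀) = M⁰ ∈ ℓ^p(w;ℝ³) is (l+1)-times continuously differentiable as a map from I into ℓ^p(w;ℝ³). -/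
open scoped ENNReal
open MeasureTheory intervalIntegral

/-- Precomposition with an injective map of index types, as a continuous linear map on `lp`. -/
noncomputable def lpCompCLM {α β E : Type*} [NormedAddCommGroup E] [NormedSpace ℝ E]
    (p : ℝ≥0∞) [Fact (1 ≤ p)] (hp : p ≠ ∞) (f : α → β) (hf : Function.Injective f) :
    lp (fun _ : β => E) p →L[ℝ] lp (fun _ : α => E) p :=
  have hp0 : 0 < p.toReal :=
    ENNReal.toReal_pos (zero_lt_one.trans_le Fact.out).ne' hp
  LinearMap.mkContinuous
    { toFun := fun x => ⟨fun a => x (f a),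
        memℓp_gen (((lp.memℓp x).summable hp0).comp_injective hf)⟩
      map_add' := fun _ _ => rfl
      map_smul' := fun _ _ => by ext; simp }
    1
    fun x => by
      rw [one_mul]
      refine lp.norm_le_of_tsum_le hp0 (norm_nonneg x) ?_
      rw [lp.norm_rpow_eq_tsum hp0]
      exact tsum_comp_le_tsum_of_inj ((lp.memℓp x).summable hp0)
        (fun _ => by positivity) hf

@[simp]
theorem lpCompCLM_apply {α β E : Type*} [NormedAddCommGroup E] [NormedSpace ℝ E]
    (p : ℝ≥0∞) [Fact (1 ≤ p)] (hp : p ≠ ∞) (f : α → β) (hf : Function.Injective f)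
    (x : lp (fun _ : β => E) p) (a : α) : lpCompCLM p hp f hf x a = x (f a) :=
  rfl

/-- Coordinatewise application of a fixed matrix, as a continuous linear map on `lp`. -/
noncomputable def lpMulVecCLM {m : Type*} [Fintype m] [DecidableEq m]
    (α : Type*) (p : ℝ≥0∞) [Fact (1 ≤ p)] (A : Matrix m m ℝ) :
    lp (fun _ : α => m → ℝ) p →L[ℝ] lp (fun _ : α => m → ℝ) p :=
  lp.mapCLM p (fun _ => LinearMap.toContinuousLinearMap (Matrix.toLin' A))
    (norm_nonneg (LinearMap.toContinuousLinearMap (Matrix.toLin' A))) (fun _ => le_rfl)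

@[simp]
theorem lpMulVecCLM_apply {m : Type*} [Fintype m] [DecidableEq m]
    (α : Type*) (p : ℝ≥0∞) [Fact (1 ≤ p)] (A : Matrix m m ℝ)
    (x : lp (fun _ : α => m → ℝ) p) (a : α) :
    lpMulVecCLM α p A x a = A.mulVec (x a) :=
  rfl

theorem matA_eq_add_smul (v : ℝ) :
    matA v = matA 0 + v • !![0, 0, 0; -1, 0, 0; 0, -2, 0] := by
  ext i j
  fin_cases i <;> fin_cases j <;> simp [matA, mul_comm]

/-- A solution of a linear equation `F' = S F + V • T F` with bounded operators `S`, `T` and a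
`C^l` coefficient `V` is `C^(l+1)`. -/
theorem contDiffOn_succ_of_hasDerivWithinAt_linear {E : Type*} [NormedAddCommGroup E]
    [NormedSpace ℝ E] {I : Set ℝ} (hI : UniqueDiffOn ℝ I) (S T : E →L[ℝ] E) {V : ℝ → ℝ}
    {F : ℝ → E} (hF : ∀ τ ∈ I, HasDerivWithinAt F (S (F τ) + V τ • T (F τ)) I τ) (l : ℕ)
    (hV : ContDiffOn ℝ l V I) : ContDiffOn ℝ (l + 1 : ℕ) F I := by
  have step (k : ℕ) (hVk : ContDiffOn ℝ k V I) (hFk : ContDiffOn ℝ k F I) :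
      ContDiffOn ℝ (k + 1 : ℕ) F I := by
    push_cast
    rw [contDiffOn_succ_iff_derivWithin hI]
    refine ⟨fun τ hτ => (hF τ hτ).differentiableWithinAt, by simp, ?_⟩
    refine ContDiffOn.congr (f := fun τ => S (F τ) + V τ • T (F τ)) ?_
      fun τ hτ => (hF τ hτ).derivWithin (hI τ hτ)
    exact (S.contDiff.comp_contDiffOn hFk).add (hVk.smul (T.contDiff.comp_contDiffOn hFk))
  induction l with
  | zero =>
    refine step 0 hV (contDiffOn_zero.2 ?_)
    exact fun τ hτ => (hF τ hτ).continuousWithinAt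
  | succ k ih => exact step (k + 1) hV (ih (hV.of_le (by exact_mod_cast Nat.le_succ k)))

/-- Proposition 4.13 of the paper. For geometrically growing weights
`w n = c·ωⁿ`, if the potential `V` is `l`-times continuously differentiable on the
interval `I`, then the (unique) continuously differentiable solution of the moment
dynamics with given initial value is `(l+1)`-times continuously differentiable as a map
into `ℓ^p(w;ℝ³)`.  Elements of `ℓ^p(w;ℝ³)` are represented by their weighted
representatives in `lp` (`F τ` represents the moment sequence `n ↦ (c·ωⁿ) • (F τ) n`). -/
theorem moment_dynamics_geometric_weights_regularity
    (p : ℝ≥0∞) [Fact (1 ≤ p)] (hp : p ≠ ∞) (c ω : ℝ) (hc : 0 < c) (hω : 0 < ω)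
    (I : Set ℝ) (hI : I.OrdConnected) (l : ℕ) (V : ℝ → ℝ)
    (hV : ContDiffOn ℝ l V I)
    (τ₀ : ℝ) (hτ₀ : τ₀ ∈ I)
    (M0 : lp (fun _ : ℕ => Fin 3 → ℝ) p)
    (F F' : ℝ → lp (fun _ : ℕ => Fin 3 → ℝ) p)
    (hF0 : F τ₀ = M0)
    (hF'c : ContinuousOn F' I)
    (hFd : ∀ τ ∈ I, HasDerivWithinAt F (F' τ) I τ)
    (hFode : ∀ τ ∈ I, ∀ n : ℕ,
      (c * ω ^ n) • (F' τ) n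
        = (matA (V τ)).mulVec ((c * ω ^ n) • (F τ) n)
          + matB.mulVec ((c * ω ^ (n + 1)) • (F τ) (n + 1))) :
    ContDiffOn ℝ (l + 1 : ℕ) F I := by
  rcases I.subsingleton_or_nontrivial with hsub | hnt
  · refine (contDiffOn_const (c := F τ₀)).congr fun τ hτ => ?_
    rw [hsub hτ hτ₀]
  have hU : UniqueDiffOn ℝ I :=
    uniqueDiffOn_convex hI.convex (hI.convex.nontrivial_iff_nonempty_interior.1 hnt)
  refine contDiffOn_succ_of_hasDerivWithinAt_linear hU
    (lpMulVecCLM ℕ p (matA 0)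
      + ω • (lpMulVecCLM ℕ p matB ∘L lpCompCLM p hp Nat.succ Nat.succ_injective))
    (lpMulVecCLM ℕ p !![0, 0, 0; -1, 0, 0; 0, -2, 0]) (fun τ hτ => ?_) l hV
  refine (hFd τ hτ).congr_deriv ?_
  ext1
  funext n
  have hw : c * ω ^ n ≠ 0 := by positivity
  refine smul_right_injective _ hw ?_
  dsimp only
  rw [hFode τ hτ n, matA_eq_add_smul (V τ), pow_succ, ← mul_assoc]
  simp only [lp.coeFn_add, lp.coeFn_smul, Pi.add_apply, Pi.smul_apply, add_apply,
    smul_apply, ContinuousLinearMap.comp_apply, lpMulVecCLM_apply,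
    lpCompCLM_apply, Matrix.add_mulVec, Matrix.smul_mulVec, Matrix.mulVec_smul, Nat.succ_eq_add_one]
  module
end

section
/- Let n, m ∈ ℕ with 0 ≤ m ≤ n, and let p ∈ (0,1) be real. Then C(n, m)·(1−p)ⁿ ≤ C(⌊m/p⌋, m)·(1−p)^⌊m/p⌋, where C(·,·) denotes the binomial coefficient and ⌊m/p⌋ is the greatest integer not exceeding m/p. -/
/-- The ratio of consecutive terms of `k ↦ C(k, m) (1 - p) ^ k`, in denominator-free form. -/
lemma choose_mul_pow_succ (k m : ℕ) (hmk : m ≤ k) (p : ℝ) :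
    ((k + 1).choose m : ℝ) * (1 - p) ^ (k + 1) * ((k : ℝ) + 1 - m)
      = (k.choose m : ℝ) * (1 - p) ^ k * (((k : ℝ) + 1) * (1 - p)) := by
  have h : (k.choose m : ℝ) * ((k : ℝ) + 1) = ((k + 1).choose m : ℝ) * ((k : ℝ) + 1 - m) := by
    have h' := congrArg (Nat.cast : ℕ → ℝ) (Nat.choose_mul_succ_eq k m)
    rw [Nat.cast_mul, Nat.cast_mul, Nat.cast_sub (by omega)] at h'
    exact_mod_cast h'
  rw [pow_succ]
  linear_combination -((1 - p) ^ k * (1 - p)) * h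

lemma choose_mul_pow_le_succ {k m : ℕ} (hmk : m ≤ k) {p : ℝ} (hp1 : p ≤ 1)
    (hk : ((k : ℝ) + 1) * p ≤ m) :
    (k.choose m : ℝ) * (1 - p) ^ k ≤ ((k + 1).choose m : ℝ) * (1 - p) ^ (k + 1) := by
  have hmk' : (m : ℝ) ≤ k := Nat.cast_le.mpr hmk
  have hq : 0 ≤ 1 - p := sub_nonneg.mpr hp1
  refine le_of_mul_le_mul_right ?_ (show (0 : ℝ) < (k : ℝ) + 1 - m by linarith)
  rw [choose_mul_pow_succ k m hmk p]
  exact mul_le_mul_of_nonneg_left (by linarith) (by positivity)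

lemma choose_mul_pow_succ_le {k m : ℕ} (hmk : m ≤ k) {p : ℝ} (hp1 : p ≤ 1)
    (hk : (m : ℝ) ≤ ((k : ℝ) + 1) * p) :
    ((k + 1).choose m : ℝ) * (1 - p) ^ (k + 1) ≤ (k.choose m : ℝ) * (1 - p) ^ k := by
  have hmk' : (m : ℝ) ≤ k := Nat.cast_le.mpr hmk
  have hq : 0 ≤ 1 - p := sub_nonneg.mpr hp1
  refine le_of_mul_le_mul_right ?_ (show (0 : ℝ) < (k : ℝ) + 1 - m by linarith)
  rw [choose_mul_pow_succ k m hmk p]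
  exact mul_le_mul_of_nonneg_left (by linarith) (by positivity)

/-- Lemma A.2 of the paper. For `0 ≤ m ≤ n` and `p ∈ (0,1)`:
`C(n,m)·(1−p)ⁿ ≤ C(⌊m/p⌋,m)·(1−p)^⌊m/p⌋`. -/
theorem binomial_floor_maximizer
    (n m : ℕ) (hmn : m ≤ n) (p : ℝ) (hp0 : 0 < p) (hp1 : p < 1) :
    (n.choose m : ℝ) * (1 - p) ^ n
      ≤ ((⌊(m : ℝ) / p⌋₊).choose m : ℝ) * (1 - p) ^ ⌊(m : ℝ) / p⌋₊ := by
  have hm : m ≤ ⌊(m : ℝ) / p⌋₊ :=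
    Nat.le_floor (le_div_self (Nat.cast_nonneg m) hp0 hp1.le)
  have hfloor : (⌊(m : ℝ) / p⌋₊ : ℝ) * p ≤ m :=
    (le_div_iff₀ hp0).mp (Nat.floor_le (by positivity))
  have hlt : (m : ℝ) < ((⌊(m : ℝ) / p⌋₊ : ℝ) + 1) * p :=
    (div_lt_iff₀ hp0).mp (Nat.lt_floor_add_one _)
  generalize ⌊(m : ℝ) / p⌋₊ = N at hm hfloor hlt ⊢
  rcases le_total n N with h | h
  · induction h using Nat.decreasingInduction with
    | self => exact le_rfl
    | of_succ k hk ih =>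
      refine (choose_mul_pow_le_succ hmn hp1.le ?_).trans (ih (by omega))
      have hkN : (k : ℝ) + 1 ≤ N := by exact_mod_cast hk
      exact (mul_le_mul_of_nonneg_right hkN hp0.le).trans hfloor
  · induction n, h using Nat.le_induction with
    | base => exact le_rfl
    | succ k hk ih =>
      refine (choose_mul_pow_succ_le (hm.trans hk) hp1.le ?_).trans (ih (hm.trans hk))
      have hNk : (N : ℝ) + 1 ≤ k + 1 := by exact_mod_cast Nat.succ_le_succ hk
      exact hlt.le.trans (mul_le_mul_of_nonneg_right hNk hp0.le)
end

section
/- Let m ≥ 1 be an integer and p ∈ (0,1) real. Then for every n ∈ ℕ: C(n+m, m)·p^m·(1−p)^n ≤ min{1, (2/√(2πm))·(1−p)^(−1/2)}. -/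
/-- An upper Stirling bound for `log k!`, centred at `k + 1/2`. -/
lemma log_factorial_le_half_shift {k : ℕ} (hk : k ≠ 0) :
    Real.log (k.factorial : ℝ)
      ≤ ((k : ℝ) + 1 / 2) * Real.log ((k : ℝ) + 1 / 2) - k + 1 / 2 := by
  obtain ⟨j, rfl⟩ := Nat.exists_eq_succ_of_ne_zero hk
  have hanti := Stirling.log_stirlingSeq'_antitone (Nat.zero_le j)
  simp only [Function.comp_apply, Stirling.log_stirlingSeq_formula, Nat.succ_eq_add_one] at hanti
  generalize hx : ((j + 1 : ℕ) : ℝ) = x at hanti ⊢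
  have hx0 : 0 < x := by rw [← hx]; positivity
  have hshift := Real.one_sub_inv_le_log_of_pos (x := (x + 1 / 2) / x) (by positivity)
  rw [Real.log_div (by positivity) (by positivity)] at hshift
  have hscaled := mul_le_mul_of_nonneg_left hshift (by positivity : 0 ≤ x + 1 / 2)
  have heq : (x + 1 / 2) * (1 - ((x + 1 / 2) / x)⁻¹) = 1 / 2 := by field_simp; ring
  rw [heq] at hscaled
  rw [Real.log_mul two_ne_zero hx0.ne', Real.log_div hx0.ne' (Real.exp_ne_zero 1),
    Real.log_exp] at hanti
  norm_num [Real.log_div] at hanti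
  linarith

/-- A lower Stirling bound for `log n!`, centred at `n + 1/2`. -/
lemma half_shift_le_log_factorial (n : ℕ) :
    ((n : ℝ) + 1 / 2) * Real.log ((n : ℝ) + 1 / 2) - n + 1 / 2 - Real.log 2
      ≤ Real.log (n.factorial : ℝ) := by
  have hlog2 := Real.log_two_gt_d9
  rcases Nat.eq_zero_or_pos n with rfl | hn
  · have hhalf : Real.log (1 / 2) = -Real.log 2 := by rw [one_div, Real.log_inv]
    norm_num
    linarith
  have hstirling := Stirling.le_log_factorial_stirling hn.ne'
  have hx1 : (1 : ℝ) ≤ n := by exact_mod_cast hn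
  generalize (n : ℝ) = x at hstirling hx1 ⊢
  have hx0 : 0 < x := by linarith
  have hshift := Real.log_le_sub_one_of_pos (x := (x + 1 / 2) / x) (by positivity)
  rw [Real.log_div (by positivity) (by positivity)] at hshift
  have hscaled := mul_le_mul_of_nonneg_left hshift (by positivity : 0 ≤ x + 1 / 2)
  have hle : (x + 1 / 2) * ((x + 1 / 2) / x - 1) ≤ 3 / 4 := by
    have heq : (x + 1 / 2) * ((x + 1 / 2) / x - 1) = 1 / 2 + 1 / 4 * x⁻¹ := by
      field_simp; ring
    have hinv := inv_le_one_of_one_le₀ hx1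
    linarith
  have hpi : Real.log 2 ≤ Real.log Real.pi :=
    Real.log_le_log two_pos Real.two_le_pi
  rw [Real.log_mul two_ne_zero Real.pi_ne_zero] at hstirling
  linarith

/-- Gibbs' inequality for two weights. -/
lemma mul_log_add_mul_log_le {a b p : ℝ} (ha : 0 < a) (hb : 0 < b) (hp0 : 0 < p) (hp1 : p < 1) :
    a * Real.log p + b * Real.log (1 - p)
      ≤ a * Real.log a + b * Real.log b - (a + b) * Real.log (a + b) := by
  have hq : 0 < 1 - p := sub_pos.mpr hp1
  have hs : 0 < a + b := by positivity
  have key : ∀ {c x : ℝ}, 0 < c → 0 < x →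
      c * (Real.log x + Real.log (a + b) - Real.log c) ≤ x * (a + b) - c := by
    intro c x hc hx
    have h := mul_le_mul_of_nonneg_left
      (Real.log_le_sub_one_of_pos (x := x * (a + b) / c) (by positivity)) hc.le
    rw [Real.log_div (by positivity) hc.ne', Real.log_mul hx.ne' hs.ne'] at h
    have heq : c * (x * (a + b) / c - 1) = x * (a + b) - c := by field_simp
    linarith
  linarith [key ha hp0, key hb hq]

lemma choose_mul_pow_mul_pow_le_one (m n : ℕ) {p : ℝ} (hp0 : 0 ≤ p) (hp1 : p ≤ 1) :
    ((n + m).choose m : ℝ) * p ^ m * (1 - p) ^ n ≤ 1 := by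
  have hq : 0 ≤ 1 - p := sub_nonneg.mpr hp1
  have hsum := add_pow p (1 - p) (n + m)
  rw [add_sub_cancel, one_pow] at hsum
  refine le_trans (le_of_eq ?_) ((Finset.single_le_sum
    (f := fun k => p ^ k * (1 - p) ^ (n + m - k) * ((n + m).choose k : ℝ))
    (fun k _ => by positivity) (Finset.mem_range.mpr (by omega : m < n + m + 1))).trans hsum.ge)
  simp only [Nat.add_sub_cancel]
  ring

lemma log_choose_add (m n : ℕ) :
    Real.log ((n + m).choose m : ℝ)
      = Real.log ((n + m).factorial : ℝ) - Real.log (n.factorial : ℝ)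
        - Real.log (m.factorial : ℝ) := by
  have h : ((n + m).choose m : ℝ) * m.factorial * n.factorial = (n + m).factorial := by
    have := Nat.choose_mul_factorial_mul_factorial (Nat.le_add_left m n)
    rw [Nat.add_sub_cancel] at this
    exact_mod_cast this
  have hc : ((n + m).choose m : ℝ) ≠ 0 := by
    exact_mod_cast (Nat.choose_pos (Nat.le_add_left m n)).ne'
  rw [← h, Real.log_mul (by positivity) (by positivity), Real.log_mul hc (by positivity)]
  ring

/-- the inequality of Proposition A.4 of the paper. For an integer
`m ≥ 1` and `p ∈ (0,1)`, for every `n`: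
`C(n+m,m)·p^m·(1−p)^n ≤ min{1, (2/√(2πm))·(1−p)^(−1/2)}`. -/
theorem binomial_max_bound
    (m : ℕ) (hm : 1 ≤ m) (p : ℝ) (hp0 : 0 < p) (hp1 : p < 1) (n : ℕ) :
    ((n + m).choose m : ℝ) * p ^ m * (1 - p) ^ n
      ≤ min 1 ((2 / Real.sqrt (2 * Real.pi * m)) * (1 - p) ^ (-(1 / 2) : ℝ)) := by
  refine le_min (choose_mul_pow_mul_pow_le_one m n hp0.le hp1.le) ?_
  have hq : 0 < 1 - p := sub_pos.mpr hp1
  have hm0 : (0 : ℝ) < m := by exact_mod_cast hm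
  have hc : (0 : ℝ) < (n + m).choose m := by
    exact_mod_cast Nat.choose_pos (Nat.le_add_left m n)
  have hpi := Real.pi_pos
  have hsqrt : 0 < Real.sqrt (2 * Real.pi * m) := Real.sqrt_pos.mpr (by positivity)
  have hpow : 0 < (1 - p) ^ (-(1 / 2) : ℝ) := Real.rpow_pos_of_pos hq _
  rw [← Real.log_le_log_iff (by positivity) (by positivity),
    Real.log_mul (by positivity) (by positivity), Real.log_mul hc.ne' (by positivity),
    Real.log_mul (by positivity) hpow.ne', Real.log_div two_ne_zero hsqrt.ne',
    Real.log_rpow hq, Real.log_sqrt (by positivity), Real.log_pow, Real.log_pow,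
    Real.log_mul (by positivity) hm0.ne', log_choose_add]
  have hupper := log_factorial_le_half_shift (k := n + m) (by omega)
  have hlower := half_shift_le_log_factorial n
  have hstirling := Stirling.le_log_factorial_stirling (n := m) (by omega)
  have hgibbs := mul_log_add_mul_log_le hm0 (by positivity : (0 : ℝ) < n + 1 / 2) hp0 hp1
  have hcomm : (m : ℝ) + (n + 1 / 2) = n + m + 1 / 2 := by ring
  rw [hcomm] at hgibbs
  push_cast at hupper
  linarith
end

section
/- For every integer n ≥ 1: ∑_{m=1}^{⌈(n+1)/2⌉} (m−1)!/(n−m)! ≤ 3/2 if n is odd, and ∑_{m=1}^{⌈(n+1)/2⌉} (m−1)!/(n−m)! ≤ n/2 + 1 if n is even. -/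
open Finset

/-- As long as `2 ≤ N`, the terms `j! / (N - j)!` at least double at each step, so a partial sum is
at most twice its last term. -/
lemma sum_factorial_div_factorial_le_two_mul_last {N : ℕ} (hN : 2 ≤ N) (i : ℕ) (hi : i ≤ N) :
    ∑ j ∈ range (i + 1), ((Nat.factorial j : ℝ) / Nat.factorial (N - j)) ≤
      2 * ((Nat.factorial i : ℝ) / Nat.factorial (N - i)) := by
  induction i with
  | zero =>
    rw [zero_add, sum_range_one]
    linarith [show (0 : ℝ) ≤ (Nat.factorial 0 : ℝ) / Nat.factorial (N - 0) by positivity]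
  | succ i ih =>
    rw [sum_range_succ]
    have key : 2 * ((Nat.factorial i : ℝ) / Nat.factorial (N - i)) ≤
        (Nat.factorial (i + 1) : ℝ) / Nat.factorial (N - (i + 1)) := by
      obtain ⟨d, rfl⟩ := Nat.exists_eq_add_of_le hi
      rw [show i + 1 + d - i = d + 1 by omega, Nat.add_sub_cancel_left,
        Nat.factorial_succ, Nat.factorial_succ, ← mul_div_assoc,
        div_le_div_iff₀ (by positivity) (by positivity)]
      have h : 2 ≤ (i + 1) * (d + 1) := by nlinarith [Nat.zero_le (i * d)]
      have h' := Nat.mul_le_mul_right (Nat.factorial i * Nat.factorial d) h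
      norm_cast
      linarith
    linarith [ih (by omega)]

lemma sum_Icc_one_factorial_div_factorial (N k : ℕ) :
    ∑ m ∈ Icc 1 k, ((Nat.factorial (m - 1) : ℝ) / Nat.factorial (N + 1 - m)) =
      ∑ j ∈ range k, ((Nat.factorial j : ℝ) / Nat.factorial (N - j)) := by
  rw [range_eq_Ico, ← Ico_add_one_right_eq_Icc,
    ← sum_Ico_add' (fun m ↦ (Nat.factorial (m - 1) : ℝ) / Nat.factorial (N + 1 - m)) 0 k 1]
  simp

/-- Proposition A.5 of the paper. For every integer `n ≥ 1`,
`∑_{m=1}^{⌈(n+1)/2⌉} (m−1)!/(n−m)!` is at most `3/2` for odd `n` and at most `n/2 + 1`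
for even `n`. -/
theorem factorial_ratio_sum_bound (n : ℕ) (hn : 1 ≤ n) :
    (Odd n →
      ∑ m ∈ Finset.Icc 1 ⌈((n : ℝ) + 1) / 2⌉₊,
          ((Nat.factorial (m - 1) : ℝ) / (Nat.factorial (n - m))) ≤ 3 / 2) ∧
    (Even n →
      ∑ m ∈ Finset.Icc 1 ⌈((n : ℝ) + 1) / 2⌉₊,
          ((Nat.factorial (m - 1) : ℝ) / (Nat.factorial (n - m))) ≤ (n : ℝ) / 2 + 1) := by
  constructor
  · rintro ⟨k, rfl⟩
    have hceil : ⌈(((2 * k + 1 : ℕ) : ℝ) + 1) / 2⌉₊ = k + 1 := by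
      rw [Nat.ceil_eq_iff (by omega)]
      push_cast
      constructor <;> linarith
    rw [hceil, sum_Icc_one_factorial_div_factorial]
    match k with
    | 0 => norm_num
    | 1 => norm_num [sum_range_succ]
    | k + 2 =>
      rw [sum_range_succ]
      have h := sum_factorial_div_factorial_le_two_mul_last
        (N := 2 * (k + 2)) (by omega) (k + 1) (by omega)
      have hlast : (Nat.factorial (k + 2) : ℝ) / Nat.factorial (2 * (k + 2) - (k + 2)) = 1 := by
        rw [show 2 * (k + 2) - (k + 2) = k + 2 by omega]
        exact div_self (by positivity)
      have hprev : (Nat.factorial (k + 1) : ℝ) / Nat.factorial (2 * (k + 2) - (k + 1)) ≤ 1 / 4 := by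
        rw [show 2 * (k + 2) - (k + 1) = k + 1 + 1 + 1 by omega, Nat.factorial_succ (k + 1 + 1),
          Nat.factorial_succ (k + 1), div_le_div_iff₀ (by positivity) (by norm_num)]
        have h4 : 4 ≤ (k + 1 + 1 + 1) * (k + 1 + 1) := by nlinarith
        have h' := Nat.mul_le_mul_right (Nat.factorial (k + 1)) h4
        norm_cast
        linarith
      linarith
  · rintro ⟨k, rfl⟩
    have hceil : ⌈(((k + k : ℕ) : ℝ) + 1) / 2⌉₊ = k + 1 := by
      rw [Nat.ceil_eq_iff (by omega)]
      push_cast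
      constructor <;> linarith
    rw [hceil]
    match k with
    | 0 => omega
    | 1 => norm_num [sum_Icc_succ_top]
    | k + 2 =>
      rw [show k + 2 + (k + 2) = 2 * k + 3 + 1 by omega, sum_Icc_one_factorial_div_factorial,
        sum_range_succ]
      have h := sum_factorial_div_factorial_le_two_mul_last
        (N := 2 * k + 3) (by omega) (k + 1) (by omega)
      have hlast : (Nat.factorial (k + 2) : ℝ) / Nat.factorial (2 * k + 3 - (k + 2)) = k + 2 := by
        rw [show 2 * k + 3 - (k + 2) = k + 1 by omega, Nat.factorial_succ (k + 1),
          div_eq_iff (by positivity)]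
        push_cast
        ring
      have hprev : (Nat.factorial (k + 1) : ℝ) / Nat.factorial (2 * k + 3 - (k + 1)) ≤ 1 / 2 := by
        rw [show 2 * k + 3 - (k + 1) = k + 1 + 1 by omega, Nat.factorial_succ (k + 1),
          div_le_div_iff₀ (by positivity) (by norm_num)]
        have h' := Nat.mul_le_mul_right (Nat.factorial (k + 1)) (show 2 ≤ k + 1 + 1 by omega)
        norm_cast
        linarith
      rw [hlast]
      push_cast
      linarith
end

section
/- For n ≥ 1 an integer and f : ℝ → ℝ (or ℂ-valued) smooth and compactly supported, define Λ_n(f) = (1/(n−1)!)·(−∫_0^∞ log(k)·f^(n)(k) dk + f^(n−1)(0)·∑_{j=1}^{n−1} 1/j), where f^(n) denotes the n-th derivative. Then for every n ≥ 1 and every smooth compactly supported f: Λ_{n+1}(g) = Λ_n(f), where g(k) = k·f(k). (That is, the extension of the homogeneous distribution k_+^{−n} defined by Λ_n satisfies the homogeneity property ⟨k_+^{−n−1}, k·f⟩ = ⟨k_+^{−n}, f⟩.) -/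
open MeasureTheory Finset

/-- The extension `Λ_n` of the homogeneous distribution `k_+^{−n}` (with length scale
`μ = 1`) applied to a test function `f`:
`Λ_n(f) = (1/(n−1)!)·(−∫_0^∞ log(k)·f^{(n)}(k) dk + f^{(n−1)}(0)·∑_{j=1}^{n−1} 1/j)`. -/
noncomputable def homogExt (n : ℕ) (f : ℝ → ℝ) : ℝ :=
  (1 / (Nat.factorial (n - 1) : ℝ)) *
    (-(∫ k in Set.Ioi (0 : ℝ), Real.log k * iteratedDeriv n f k)
      + iteratedDeriv (n - 1) f 0 * ∑ j ∈ Finset.Icc 1 (n - 1), (1 : ℝ) / j)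

open scoped ContDiff in
theorem contDiff_infty_iteratedDeriv {f : ℝ → ℝ} (hf : ContDiff ℝ ∞ f) (m : ℕ) :
    ContDiff ℝ ∞ (iteratedDeriv m f) := by
  rw [iteratedDeriv_eq_iterate]
  exact hf.iterate_deriv m

theorem hasCompactSupport_iteratedDeriv {f : ℝ → ℝ} (hf : HasCompactSupport f) (m : ℕ) :
    HasCompactSupport (iteratedDeriv m f) := by
  induction m with
  | zero => simpa using hf
  | succ m ih =>
    rw [iteratedDeriv_succ]
    exact ih.deriv

open scoped ContDiff in
theorem iteratedDeriv_succ_id_mul {f : ℝ → ℝ} (hf : ContDiff ℝ ∞ f) (m : ℕ) :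
    iteratedDeriv (m + 1) (fun k => k * f k) =
      fun k => k * iteratedDeriv (m + 1) f k + (m + 1) * iteratedDeriv m f k := by
  have hd (i : ℕ) (x : ℝ) : HasDerivAt (iteratedDeriv i f) (iteratedDeriv (i + 1) f x) x := by
    rw [iteratedDeriv_succ]
    exact ((contDiff_infty_iteratedDeriv hf i).differentiable (by simp) x).hasDerivAt
  induction m with
  | zero =>
    ext x
    have h := ((hasDerivAt_id x).mul (hd 0 x)).deriv
    simp only [iteratedDeriv_zero] at h
    rw [iteratedDeriv_one]
    refine Eq.trans h ?_
    simp [add_comm]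
  | succ m ih =>
    ext x
    rw [iteratedDeriv_succ, ih]
    refine (((hasDerivAt_id x).mul (hd (m + 1) x)).add
      ((hd m x).const_mul ((m : ℝ) + 1))).deriv.trans ?_
    simp only [id]
    push_cast
    ring

theorem locallyIntegrable_log : LocallyIntegrable Real.log := by
  refine locallyIntegrable_iff.mpr fun K hK => ?_
  obtain ⟨R, hR⟩ := hK.isBounded.subset_closedBall 0
  rw [Real.closedBall_eq_Icc] at hR
  refine IntegrableOn.mono_set ?_ (hR.trans Set.Icc_subset_uIcc)
  exact (intervalIntegrable_iff' (by simp)).mp intervalIntegral.intervalIntegrable_log'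

theorem integrable_log_mul {q : ℝ → ℝ} (hq : Continuous q) (hs : HasCompactSupport q) :
    Integrable fun k => Real.log k * q k := by
  simpa only [smul_eq_mul] using
    locallyIntegrable_log.integrable_smul_right_of_hasCompactSupport hq hs

/-- The integrand is the derivative of `k * log k * p' k - p k`. -/
theorem integral_log_mul_deriv_id_mul_deriv {p : ℝ → ℝ} (hp : ContDiff ℝ 2 p)
    (hs : HasCompactSupport p) :
    ∫ k in Set.Ioi (0 : ℝ), Real.log k * (k * deriv (deriv p) k + deriv p k) = p 0 := by
  have hp' : ContDiff ℝ 1 (deriv p) := ContDiff.deriv' hp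
  have hp'' : Continuous (deriv (deriv p)) := hp'.continuous_deriv le_rfl
  have hcont : Continuous fun k => k * Real.log k * deriv p k - p k :=
    (Real.continuous_mul_log.mul hp'.continuous).sub hp.continuous
  have hlim : Filter.Tendsto (fun k => k * Real.log k * deriv p k - p k) Filter.atTop
      (nhds 0) := by
    have hsupp : HasCompactSupport fun k => k * Real.log k * deriv p k - p k :=
      (hs.deriv.mul_left (f := fun k => k * Real.log k)).sub hs
    exact hsupp.is_zero_at_infty.mono_left atTop_le_cocompact
  have hint : Integrable fun k => Real.log k * (k * deriv (deriv p) k + deriv p k) :=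
    integrable_log_mul ((continuous_id.mul hp'').add hp'.continuous)
      ((hs.deriv.deriv.mul_left (f := fun k => k)).add hs.deriv)
  rw [integral_Ioi_of_hasDerivAt_of_tendsto hcont.continuousWithinAt
    (fun x hx => ?_) hint.integrableOn hlim]
  · simp
  · have h1 := (hp.differentiable two_ne_zero x).hasDerivAt
    have h2 := (hp'.differentiable one_ne_zero x).hasDerivAt
    convert! ((Real.hasDerivAt_mul_log (ne_of_gt hx)).mul h2).sub h1 using 1
    ring

/-- the homogeneity property of Section A.1 of the paper. For every
`n ≥ 1` and every smooth compactly supported `f`, one has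
`⟨k_+^{−(n+1)}, k·f⟩ = ⟨k_+^{−n}, f⟩`. -/
theorem homogExt_homogeneity
    (n : ℕ) (hn : 1 ≤ n) (f : ℝ → ℝ)
    (hf : ContDiff ℝ (⊤ : ℕ∞) f) (hsupp : HasCompactSupport f) :
    homogExt (n + 1) (fun k => k * f k) = homogExt n f := by
  obtain ⟨m, rfl⟩ := Nat.exists_eq_add_of_le' hn
  have hint (i : ℕ) : Integrable fun k => Real.log k * iteratedDeriv i f k :=
    integrable_log_mul (contDiff_infty_iteratedDeriv hf i).continuous
      (hasCompactSupport_iteratedDeriv hsupp i)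
  have key := integral_log_mul_deriv_id_mul_deriv
    ((contDiff_infty_iteratedDeriv hf m).of_le (WithTop.coe_le_coe.mpr (le_top (a := (2 : ℕ∞)))))
    (hasCompactSupport_iteratedDeriv hsupp m)
  simp only [← iteratedDeriv_succ] at key
  have hkey : Integrable fun k => Real.log k *
      (k * iteratedDeriv (m + 1 + 1) f k + iteratedDeriv (m + 1) f k) :=
    integrable_log_mul
      ((continuous_id.mul (contDiff_infty_iteratedDeriv hf _).continuous).add
        (contDiff_infty_iteratedDeriv hf _).continuous)
      (((hasCompactSupport_iteratedDeriv hsupp _).mul_left (f := fun k => k)).add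
        (hasCompactSupport_iteratedDeriv hsupp _))
  have hI : ∫ k in Set.Ioi (0 : ℝ),
      Real.log k * iteratedDeriv (m + 1 + 1) (fun k => k * f k) k =
      iteratedDeriv m f 0 +
        (m + 1) * ∫ k in Set.Ioi (0 : ℝ), Real.log k * iteratedDeriv (m + 1) f k := by
    rw [← key, ← integral_const_mul,
      ← integral_add hkey.integrableOn ((hint _).const_mul _).integrableOn,
      iteratedDeriv_succ_id_mul hf]
    refine integral_congr_ae (.of_forall fun k => ?_)
    push_cast
    ring
  simp only [homogExt, Nat.add_sub_cancel, hI]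
  rw [iteratedDeriv_succ_id_mul hf, Finset.sum_Icc_succ_top (by lia), Nat.factorial_succ]
  have := Nat.factorial_ne_zero m
  push_cast
  field_simp
  ring
end
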